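/- arXiv:1609.00933 — 2 statements merged into one kernel-verified Lean document; each statement's English description precedes it below -/
import Mathlib

section
/- Every compact graph-like space X is homeomorphic to the inverse limit of an inverse sequence (G_n, f_n)_{n∈ℕ} of topological finite multi-graphs with surjective simplicial bonding maps f_n : G_{n+1} → G_n whose fibres are singletons except possibly over vertices of G_n, such that: (1) X is connected if and only if G_n is connected for every n; and (2) every cut of X is even if and only if for every n every vertex v of G_n is even, i.e. the cut E({v}, V(G_n)∖{v}) has even cardinality. Moreover, if X is connected, the bonding maps can additionally be chosen to be monotone (all fibres connected). -/
open Set Topology Filter Function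

universe u

/-- A compact graph-like space structure on a topological space `X`:
a closed zero-dimensional vertex set `V` together with an index type `E`
(carrying the discrete topology) such that `X \ V ≅ E × (0,1)`. -/
structure GraphLike (X : Type u) [TopologicalSpace X] where
  V : Set X
  closedV : IsClosed V
  zeroDimV : TotallyDisconnectedSpace V
  E : Type
  homeo :
    letI : TopologicalSpace E := ⊥
    Nonempty ((Vᶜ : Set X) ≃ₜ (E × ↥(Set.Ioo (0 : ℝ) 1)))

variable {X : Type u} [TopologicalSpace X]

/-- An edge of a graph-like space: a connected component of `X \ V`. -/
def GraphLike.IsEdge (G : GraphLike X) (e : Set X) : Prop :=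
  ∃ x, x ∈ (G.V)ᶜ ∧ e = connectedComponentIn (G.V)ᶜ x

/-- A subset of the vertex set which is clopen in the subspace `V`. -/
def GraphLike.ClopenIn (G : GraphLike X) (C : Set X) : Prop :=
  C ⊆ G.V ∧ IsClosed C ∧ IsClosed (G.V \ C)

/-- A separation of a graph-like space: a partition of the vertex set into
two disjoint clopen pieces. -/
structure GraphLike.Separation (G : GraphLike X) where
  A : Set X
  B : Set X
  clopenA : G.ClopenIn A
  clopenB : G.ClopenIn B
  disjoint : A ∩ B = ∅
  union : A ∪ B = G.V

/-- The cut induced by a pair of vertex sets: all edges whose closure meets both. -/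
def GraphLike.cut (G : GraphLike X) (A B : Set X) : Set (Set X) :=
  {e | G.IsEdge e ∧ (closure e ∩ A).Nonempty ∧ (closure e ∩ B).Nonempty}

/-- A cut is even if it is finite of even cardinality. -/
def GraphLike.EvenCut (G : GraphLike X) (A B : Set X) : Prop :=
  (G.cut A B).Finite ∧ Even (G.cut A B).ncard

/-- A bundled compact graph-like topological space. -/
structure TopGraphLike where
  carrier : Type
  [topology : TopologicalSpace carrier]
  [compact : CompactSpace carrier]
  [metrizable : TopologicalSpace.MetrizableSpace carrier]
  gl : GraphLike carrier

instance (G : TopGraphLike) : TopologicalSpace G.carrier := G.topology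
instance (G : TopGraphLike) : CompactSpace G.carrier := G.compact
instance (G : TopGraphLike) : TopologicalSpace.MetrizableSpace G.carrier := G.metrizable

/-- A topological finite multi-graph: a compact graph-like space with finitely many
vertices and finitely many edges. -/
def TopGraphLike.IsFiniteMultiGraph (G : TopGraphLike) : Prop :=
  G.gl.V.Finite ∧ {e | G.gl.IsEdge e}.Finite

/-- A map between graph-like spaces is simplicial if it maps vertices to vertices and
maps each edge either onto a single vertex or homeomorphically onto an edge. -/
def Simplicial {Y Z : Type*} [TopologicalSpace Y] [TopologicalSpace Z]
    (G : GraphLike Y) (H : GraphLike Z) (f : Y → Z) : Prop :=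
  Continuous f ∧ (∀ v ∈ G.V, f v ∈ H.V) ∧
    ∀ e, G.IsEdge e →
      (∃ v ∈ H.V, f '' e = {v}) ∨
      (H.IsEdge (f '' e) ∧ ∃ h : e ≃ₜ (f '' e), ∀ x : e, (h x : Z) = f x)

/-- The inverse limit of a sequence of bundled spaces along bonding maps. -/
abbrev InvLim (Y : ℕ → TopGraphLike) (f : ∀ n, (Y (n + 1)).carrier → (Y n).carrier) :
    Type :=
  {x : ∀ n, (Y n).carrier // ∀ n, f n (x (n + 1)) = x n}


set_option linter.unusedSectionVars false
set_option linter.style.haveILetI false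

/-! ### Edges of a graph-like space, via an open embedding -/

abbrev I01 : Type := ↥(Set.Ioo (0 : ℝ) 1)

/-- The edge of index `i`. -/
def edg {Z : Type*} {E : Type} (ψ : E × I01 → Z) (i : E) : Set Z :=
  Set.range fun t => ψ (i, t)

section Edges

variable {Z : Type*} [TopologicalSpace Z] {E : Type} [TopologicalSpace E] [DiscreteTopology E]
  {ψ : E × I01 → Z}

instance : PreconnectedSpace I01 := isPreconnected_iff_preconnectedSpace.1 isPreconnected_Ioo

theorem midI : (1/2 : ℝ) ∈ Set.Ioo (0 : ℝ) 1 := by constructor <;> norm_num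

instance : Nonempty I01 := ⟨⟨1/2, midI⟩⟩

theorem edg_preconnected (hψ : IsOpenEmbedding ψ) (i : E) : IsPreconnected (edg ψ i) :=
  isPreconnected_range (hψ.continuous.comp (by fun_prop))

theorem edg_eq_image (i : E) : edg ψ i = ψ '' (({i} : Set E) ×ˢ Set.univ) := by
  ext x; constructor
  · rintro ⟨t, rfl⟩; exact ⟨(i, t), by simp, rfl⟩
  · rintro ⟨⟨j, t⟩, h, rfl⟩
    simp at h; subst h; exact ⟨t, rfl⟩

theorem edg_isOpen (hψ : IsOpenEmbedding ψ) (i : E) : IsOpen (edg ψ i) := by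
  rw [edg_eq_image]
  exact hψ.isOpenMap _ ((isOpen_discrete _).prod isOpen_univ)

theorem edg_nonempty (i : E) : (edg ψ i).Nonempty := Set.range_nonempty _

theorem edg_disjoint (hψ : IsOpenEmbedding ψ) {i j : E} (h : i ≠ j) :
    Disjoint (edg ψ i) (edg ψ j) := by
  rw [Set.disjoint_left]
  rintro x ⟨t, rfl⟩ ⟨t', h'⟩
  have := hψ.injective h'
  simp at this
  exact h this.1.symm

theorem edg_injective (hψ : IsOpenEmbedding ψ) : Function.Injective (edg ψ) := by
  intro i j h
  by_contra hne
  obtain ⟨x, hx⟩ := edg_nonempty (ψ := ψ) i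
  exact Set.disjoint_left.1 (edg_disjoint hψ hne) hx (h ▸ hx)

theorem edg_component (hψ : IsOpenEmbedding ψ) (i : E) (t : I01) :
    connectedComponentIn (Set.range ψ) (ψ (i, t)) = edg ψ i := by
  apply Set.Subset.antisymm
  · refine IsPreconnected.subset_left_of_subset_union (edg_isOpen hψ i)
      (v := ⋃ j ∈ {j | j ≠ i}, edg ψ j) (isOpen_biUnion fun j _ => edg_isOpen hψ j) ?_ ?_ ?_
      isPreconnected_connectedComponentIn
    · rw [Set.disjoint_iUnion₂_right]
      intro j hj
      exact edg_disjoint hψ (Ne.symm hj)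
    · refine (connectedComponentIn_subset _ _).trans ?_
      rintro _ ⟨⟨j, s⟩, rfl⟩
      by_cases h : j = i
      · subst h; left; exact ⟨s, rfl⟩
      · right; exact Set.mem_biUnion h ⟨s, rfl⟩
    · exact ⟨ψ (i, t), mem_connectedComponentIn ⟨_, rfl⟩, ⟨t, rfl⟩⟩
  · apply (edg_preconnected hψ i).subset_connectedComponentIn ⟨t, rfl⟩
    rintro _ ⟨s, rfl⟩; exact ⟨_, rfl⟩

theorem isEdge_iff (hψ : IsOpenEmbedding ψ) (H : GraphLike Z) (hr : Set.range ψ = H.Vᶜ)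
    (e : Set Z) : H.IsEdge e ↔ ∃ i, e = edg ψ i := by
  constructor
  · rintro ⟨x, hx, rfl⟩
    rw [← hr] at hx
    obtain ⟨⟨i, t⟩, rfl⟩ := hx
    exact ⟨i, by rw [← hr, edg_component hψ]⟩
  · rintro ⟨i, rfl⟩
    exact ⟨ψ (i, ⟨1/2, midI⟩), by rw [← hr]; exact ⟨_, rfl⟩, by rw [← hr, edg_component hψ]⟩

/-- index version of the cut -/
def icut (ψ : E × I01 → Z) (A B : Set Z) : Set E :=
  {i | (closure (edg ψ i) ∩ A).Nonempty ∧ (closure (edg ψ i) ∩ B).Nonempty}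

theorem cut_eq (hψ : IsOpenEmbedding ψ) (H : GraphLike Z) (hr : Set.range ψ = H.Vᶜ)
    (A B : Set Z) : H.cut A B = edg ψ '' icut ψ A B := by
  ext e
  constructor
  · rintro ⟨h1, h2, h3⟩
    obtain ⟨i, rfl⟩ := (isEdge_iff hψ H hr e).1 h1
    exact ⟨i, ⟨h2, h3⟩, rfl⟩
  · rintro ⟨i, ⟨h2, h3⟩, rfl⟩
    exact ⟨(isEdge_iff hψ H hr _).2 ⟨i, rfl⟩, h2, h3⟩

theorem evenCut_iff (hψ : IsOpenEmbedding ψ) (H : GraphLike Z) (hr : Set.range ψ = H.Vᶜ)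
    (A B : Set Z) :
    H.EvenCut A B ↔ (icut ψ A B).Finite ∧ Even (icut ψ A B).ncard := by
  unfold GraphLike.EvenCut
  rw [cut_eq hψ H hr, Set.ncard_image_of_injective _ (edg_injective hψ),
    Set.finite_image_iff (edg_injective hψ).injOn]

theorem closure_edg (hψ : IsOpenEmbedding ψ) (i : E) {x : Z} (hx : x ∈ closure (edg ψ i))
    (hr : x ∈ Set.range ψ) : x ∈ edg ψ i := by
  obtain ⟨⟨j, t⟩, rfl⟩ := hr
  by_cases h : j = i
  · subst h; exact ⟨t, rfl⟩
  · exfalso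
    have := (edg_disjoint hψ h).closure_right (edg_isOpen hψ j)
    exact Set.disjoint_left.1 this ⟨t, rfl⟩ hx

/-- reversed parametrisation -/
def revI : I01 ≃ₜ I01 where
  toFun t := ⟨1 - t.1, by have := t.2; simp only [Set.mem_Ioo] at *; constructor <;> linarith⟩
  invFun t := ⟨1 - t.1, by have := t.2; simp only [Set.mem_Ioo] at *; constructor <;> linarith⟩
  left_inv t := by simp
  right_inv t := by simp
  continuous_toFun := by fun_prop
  continuous_invFun := by fun_prop

variable [CompactSpace Z] [TopologicalSpace.MetrizableSpace Z]

theorem compact_cover (hψ : IsOpenEmbedding ψ) {C : Set Z} (hC : IsClosed C)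
    (h : C ⊆ Set.range ψ) : ∃ F : Set E, F.Finite ∧ C ⊆ ⋃ i ∈ F, edg ψ i := by
  obtain ⟨t, ht⟩ := hC.isCompact.elim_finite_subcover (fun i => edg ψ i)
    (fun i => edg_isOpen hψ i) (by
      intro x hx
      obtain ⟨⟨i, t⟩, rfl⟩ := h hx
      exact Set.mem_iUnion.2 ⟨i, t, rfl⟩)
  exact ⟨t, t.finite_toSet, by simpa using ht⟩

theorem sep_open (hψ : IsOpenEmbedding ψ) {A B : Set Z} (hA : IsClosed A) (hB : IsClosed B)
    (hd : Disjoint A B) (hu : A ∪ B = (Set.range ψ)ᶜ) :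
    ∃ U W, IsOpen U ∧ IsOpen W ∧ Disjoint U W ∧ A ⊆ U ∧ B ⊆ W ∧
      ∃ F : Set E, F.Finite ∧ (U ∪ W)ᶜ ⊆ ⋃ i ∈ F, edg ψ i := by
  obtain ⟨U, W, hU, hW, hAU, hBW, hUW⟩ := normal_separation hA hB hd
  refine ⟨U, W, hU, hW, hUW, hAU, hBW, compact_cover hψ (hU.union hW).isClosed_compl ?_⟩
  rw [Set.compl_subset_comm, ← hu]
  exact Set.union_subset_union hAU hBW

theorem vclosed (hψ : IsOpenEmbedding ψ) : IsClosed (Set.range ψ)ᶜ :=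
  hψ.isOpen_range.isClosed_compl

theorem exists_clopen (hψ : IsOpenEmbedding ψ)
    (hT : TotallyDisconnectedSpace ((Set.range ψ)ᶜ : Set Z)) {x : Z} (hx : x ∉ Set.range ψ)
    {U : Set Z} (hU : IsOpen U) (hxU : x ∈ U) :
    ∃ A B : Set Z, IsClosed A ∧ IsClosed B ∧ Disjoint A B ∧ A ∪ B = (Set.range ψ)ᶜ ∧
      x ∈ A ∧ A ⊆ U := by
  have : CompactSpace ((Set.range ψ)ᶜ : Set Z) :=
    isCompact_iff_compactSpace.1 (vclosed hψ).isCompact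
  obtain ⟨C, hC, hxC, hCU⟩ := compact_exists_isClopen_in_isOpen
    (X := ((Set.range ψ)ᶜ : Set Z)) (x := ⟨x, hx⟩) (hU.preimage continuous_subtype_val) hxU
  have hce := (vclosed hψ).isClosedEmbedding_subtypeVal
  refine ⟨Subtype.val '' C, Subtype.val '' Cᶜ, hce.isClosedMap _ hC.isClosed,
    hce.isClosedMap _ hC.compl.isClosed, ?_, ?_, ⟨_, hxC, rfl⟩, ?_⟩
  · exact (Set.disjoint_image_iff Subtype.val_injective).2 disjoint_compl_right
  · rw [← Set.image_union, Set.union_compl_self, Set.image_univ, Subtype.range_coe]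
  · rintro _ ⟨y, hy, rfl⟩; exact hCU hy

/-- The end of an edge: a vertex to which it converges. -/
theorem exists_end (hψ : IsOpenEmbedding ψ)
    (hT : TotallyDisconnectedSpace ((Set.range ψ)ᶜ : Set Z)) (i : E) :
    ∃ s, s ∉ Set.range ψ ∧ s ∈ closure (edg ψ i) ∧ ∀ U, IsOpen U → s ∈ U →
      ∃ r : ℝ, 0 < r ∧ r < 1 ∧ ∀ t : I01, t.1 < r → ψ (i, t) ∈ U := by
  let T : ℝ → Set Z := fun r => (fun t => ψ (i, t)) '' {t : I01 | t.1 < r}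
  have hTm : ∀ r r', r ≤ r' → T r ⊆ T r' := fun r r' h =>
    Set.image_mono fun t (ht : t.1 < r) => lt_of_lt_of_le ht h
  have hcont : Continuous fun t => ψ (i, t) := hψ.continuous.comp (by fun_prop)
  have hTp : ∀ r, IsPreconnected (T r) := by
    intro r
    refine IsPreconnected.image ?_ _ hcont.continuousOn
    have h2 : (Subtype.val '' {t : I01 | t.1 < r}) = Set.Ioo (0:ℝ) 1 ∩ Set.Iio r := by
      ext x; simp [and_comm]
    apply (IsInducing.subtypeVal.isPreconnected_image).1
    rw [h2]
    exact ((Set.ordConnected_Ioo).inter Set.ordConnected_Iio).isPreconnected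
  have hne : ∀ n : ℕ, (T (1 / ((n:ℝ) + 1))).Nonempty := by
    intro n
    have h : (0:ℝ) < 1 / ((n:ℝ)+1) := by positivity
    have h1 : 1 / ((n:ℝ)+1) ≤ 1 := by
      rw [div_le_one (by positivity)]; linarith [(Nat.cast_nonneg n : (0:ℝ) ≤ n)]
    exact ⟨_, ⟨⟨(1 / ((n:ℝ)+1)) / 2, by constructor <;> linarith⟩, by
      simp only [Set.mem_ofPred_eq]; linarith, rfl⟩⟩
  obtain ⟨s, hs⟩ := IsCompact.nonempty_iInter_of_sequence_nonempty_isCompact_isClosed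
    (fun n : ℕ => closure (T (1 / ((n:ℝ) + 1))))
    (fun n => closure_mono (hTm _ _ (by
      apply one_div_le_one_div_of_le <;> push_cast <;> [positivity; linarith])))
    (fun n => (hne n).closure) isClosed_closure.isCompact (fun n => isClosed_closure)
  rw [Set.mem_iInter] at hs
  have hs' : ∀ r, 0 < r → s ∈ closure (T r) := by
    intro r hr
    obtain ⟨n, hn⟩ := exists_nat_one_div_lt hr
    exact closure_mono (hTm _ _ hn.le) (hs n)
  have hse : s ∈ closure (edg ψ i) := closure_mono (Set.image_subset_range _ _) (hs 0)
  have hsV : s ∉ Set.range ψ := by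
    intro hsr
    obtain ⟨u, rfl⟩ := closure_edg hψ i hse hsr
    have h1 := hs' u.1 u.2.1
    -- use half
    have h2 := hs' (u.1 / 2) (by have := u.2.1; linarith)
    let N : Set Z := ψ '' {z | u.1 / 2 < z.2.1}
    have hN : IsOpen N := hψ.isOpenMap _ (isOpen_lt continuous_const (by fun_prop))
    obtain ⟨x, ⟨z, hz, hzx⟩, ⟨t, ht, htx⟩⟩ := mem_closure_iff.1 h2 N hN
      ⟨(i, u), by simp only [Set.mem_ofPred_eq]; have := u.2.1; linarith, rfl⟩
    have : (i, t) = z := hψ.injective (htx.trans hzx.symm)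
    subst this
    simp only [Set.mem_ofPred_eq] at hz ht
    linarith
  refine ⟨s, hsV, hse, fun U hU hsU => ?_⟩
  obtain ⟨A, B, hA, hB, hAB, hu, hsA, hAU⟩ := exists_clopen hψ hT hsV hU hsU
  obtain ⟨U', W, hU', hW, hAU', hBW, hUW⟩ := normal_separation hA hB hAB
  have hO : IsOpen (U ∩ U') := hU.inter hU'
  have hC : IsCompact (ψ ⁻¹' ((U ∩ U') ∪ W)ᶜ) := by
    apply hψ.isInducing.isCompact_preimage' (hO.union hW).isClosed_compl.isCompact
    rw [Set.compl_subset_comm, ← hu]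
    exact Set.union_subset_union (Set.subset_inter hAU hAU') hBW
  have hC' : IsCompact ((fun z : E × I01 => z.2.1) '' (ψ ⁻¹' ((U ∩ U') ∪ W)ᶜ)) :=
    hC.image (by fun_prop)
  obtain ⟨r, hr0, hr1, hr⟩ : ∃ r : ℝ, 0 < r ∧ r < 1 ∧ ∀ t : I01, t.1 < r →
      ψ (i, t) ∈ (U ∩ U') ∪ W := by
    rcases Set.eq_empty_or_nonempty
      ((fun z : E × I01 => z.2.1) '' (ψ ⁻¹' ((U ∩ U') ∪ W)ᶜ)) with h | h
    · refine ⟨1/2, by norm_num, by norm_num, fun t _ => ?_⟩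
      by_contra hcon
      have : t.1 ∈ (∅ : Set ℝ) := h ▸ ⟨(i, t), hcon, rfl⟩
      exact this
    · obtain ⟨r, hr, hmin⟩ := hC'.exists_isLeast h
      obtain ⟨z, hz, rfl⟩ := hr
      refine ⟨z.2.1, z.2.2.1, z.2.2.2, fun t ht => ?_⟩
      by_contra hcon
      exact absurd (hmin ⟨(i, t), hcon, rfl⟩) (not_le.2 ht)
  refine ⟨r, hr0, hr1, ?_⟩
  have hsub : T r ⊆ (U ∩ U') ∪ W := by rintro _ ⟨t, ht, rfl⟩; exact hr t ht
  have hmeet := mem_closure_iff.1 (hs' r hr0) _ hO ⟨hsU, hAU' hsA⟩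
  have := (hTp r).subset_left_of_subset_union hO hW (hUW.mono_left Set.inter_subset_right) hsub
    (by rwa [Set.inter_comm])
  intro t ht
  exact (this ⟨t, ht, rfl⟩).1

theorem exists_ends (hψ : IsOpenEmbedding ψ)
    (hT : TotallyDisconnectedSpace ((Set.range ψ)ᶜ : Set Z)) (i : E) :
    ∃ s t, s ∉ Set.range ψ ∧ t ∉ Set.range ψ ∧ 
      ∀ x, x ∉ Set.range ψ → (x ∈ closure (edg ψ i) ↔ x = s ∨ x = t) := by
  obtain ⟨s, hsV, hse, hs⟩ := exists_end hψ hT i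
  let ρ : E × I01 ≃ₜ E × I01 := (Homeomorph.refl E).prodCongr revI
  have hψ' : IsOpenEmbedding (ψ ∘ ρ) := hψ.comp ρ.isOpenEmbedding
  have hr : Set.range (ψ ∘ ρ) = Set.range ψ := ρ.surjective.range_comp ψ
  have he : edg (ψ ∘ ρ) i = edg ψ i := by
    unfold edg
    exact revI.surjective.range_comp (fun t => ψ (i, t))
  obtain ⟨t, htV, hte, ht⟩ := exists_end hψ' (by rw [hr]; exact hT) i
  rw [hr] at htV
  rw [he] at hte
  refine ⟨s, t, hsV, htV, fun x hx => ⟨fun hxe => ?_, ?_⟩⟩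
  · by_contra hcon
    push Not at hcon
    obtain ⟨U1, U2, hU1, hU2, h1, h2, h12⟩ := t2_separation hcon.1.symm
    obtain ⟨U3, U4, hU3, hU4, h3, h4, h34⟩ := t2_separation hcon.2.symm
    obtain ⟨r, hr0, hr1, hr⟩ := hs U1 hU1 h1
    obtain ⟨r', hr0', hr1', hr'⟩ := ht U3 hU3 h3
    let M : Set Z := ψ '' (({i} : Set E) ×ˢ (Subtype.val ⁻¹' Set.Icc r (1 - r')))
    have hM : IsClosed M := by
      apply IsCompact.isClosed
      refine (isCompact_singleton.prod ?_).image hψ.continuous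
      apply IsInducing.subtypeVal.isCompact_preimage' isCompact_Icc
      rw [Subtype.range_coe]
      intro y hy; constructor <;> [linarith [hy.1]; linarith [hy.2]]
    have hxM : x ∉ M := fun ⟨z, _, hz⟩ => hx ⟨z, hz⟩
    obtain ⟨y, ⟨⟨hy2, hy4⟩, hyM⟩, ⟨u, rfl⟩⟩ := mem_closure_iff.1 hxe (U2 ∩ U4 ∩ Mᶜ)
      ((hU2.inter hU4).inter hM.isOpen_compl) ⟨⟨h2, h4⟩, hxM⟩
    rcases lt_or_ge u.1 r with h | h
    · exact Set.disjoint_left.1 h12 (hr u h) hy2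
    rcases lt_or_ge (1 - r') u.1 with h' | h'
    · have := hr' (revI u) (by show 1 - u.1 < r'; linarith)
      have h5 : (ψ ∘ ρ) (i, revI u) = ψ (i, u) := by
        show ψ (i, revI (revI u)) = _
        congr 2
        exact revI.left_inv u
      rw [h5] at this
      exact Set.disjoint_left.1 h34 this hy4
    · exact hyM ⟨(i, u), ⟨rfl, h, h'⟩, rfl⟩
  · rintro (rfl | rfl) <;> assumption

theorem countable_E (hψ : IsOpenEmbedding ψ) : Countable E := by
  have : TopologicalSpace.SeparableSpace Z := inferInstance
  exact Pairwise.countable_of_isOpen_disjoint (s := fun i => edg ψ i)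
    (fun i j h => edg_disjoint hψ h) (fun i => edg_isOpen hψ i) (fun i => edg_nonempty i)

end Edges

/-! ### Stages: finite quotients -/

structure Stage {X : Type u} [TopologicalSpace X] {E : Type} (ψ : E × I01 → X) where
  F : Set E
  finF : F.Finite
  ι : Type
  finι : Finite ι
  p : X → ι
  closed : ∀ a, IsClosed {x | (∀ i ∈ F, x ∉ edg ψ i) ∧ p x = a}
  surj : ∀ a, ∃ x, (∀ i ∈ F, x ∉ edg ψ i) ∧ p x = a

namespace Stage

section A

variable {E : Type} {ψ : E × I01 → X} (S : Stage ψ)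

def K : Set X := {x | ∀ i ∈ S.F, x ∉ edg ψ i}

/-- carrier of the quotient -/
def Y : Type := S.ι ⊕ (S.F × I01)

def vtx (a : S.ι) : S.Y := Sum.inl a

def ψY (z : S.F × I01) : S.Y := Sum.inr z

open Classical in
noncomputable def q (x : X) : S.Y :=
  if h : ∃ z : S.F × I01, ψ (z.1, z.2) = x then S.ψY h.choose else S.vtx (S.p x)

noncomputable instance : TopologicalSpace S.Y := TopologicalSpace.coinduced S.q inferInstance

theorem q_K {x : X} (hx : x ∈ S.K) : S.q x = S.vtx (S.p x) := by
  unfold q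
  rw [dif_neg]
  rintro ⟨z, hz⟩
  exact hx z.1 z.1.2 ⟨z.2, hz⟩

theorem q_edge (hψ : Function.Injective ψ) (z : S.F × I01) :
    S.q (ψ (z.1, z.2)) = S.ψY z := by
  unfold q
  have h : ∃ z' : S.F × I01, ψ (z'.1, z'.2) = ψ (z.1, z.2) := ⟨z, rfl⟩
  rw [dif_pos h]
  congr 1
  have := hψ h.choose_spec
  simp only [Prod.mk.injEq] at this
  exact Prod.ext (Subtype.ext this.1) this.2

theorem K_or (x : X) : x ∈ S.K ∨ ∃ z : S.F × I01, x = ψ (z.1, z.2) := by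
  by_cases h : x ∈ S.K
  · exact Or.inl h
  · right
    simp only [K, Set.mem_ofPred_eq, not_forall, not_not] at h
    obtain ⟨i, hi, t, ht⟩ := h
    exact ⟨(⟨i, hi⟩, t), ht.symm⟩

theorem not_K (z : S.F × I01) : ψ (z.1, z.2) ∉ S.K := fun h => h z.1 z.1.2 ⟨z.2, rfl⟩

theorem vtx_inj : Function.Injective S.vtx := Sum.inl_injective

theorem ψY_inj : Function.Injective S.ψY := Sum.inr_injective

theorem vtx_ne (a : S.ι) (z : S.F × I01) : S.vtx a ≠ S.ψY z := Sum.inl_ne_inr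

theorem q_surj (hψ : Function.Injective ψ) : Function.Surjective S.q := by
  rintro (a | z)
  · obtain ⟨x, hx, rfl⟩ := S.surj a
    exact ⟨x, S.q_K hx⟩
  · exact ⟨_, S.q_edge hψ z⟩

theorem q_quot (hψ : Function.Injective ψ) : IsQuotientMap S.q :=
  ⟨⟨rfl⟩, S.q_surj hψ⟩

theorem q_cont : Continuous S.q := continuous_coinduced_rng

theorem q_eq_vtx (hψ : Function.Injective ψ) {x : X} {a : S.ι} :
    S.q x = S.vtx a ↔ x ∈ S.K ∧ S.p x = a := by
  rcases S.K_or x with h | ⟨z, rfl⟩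
  · rw [S.q_K h, S.vtx_inj.eq_iff]; simp [h]
  · rw [S.q_edge hψ]
    constructor
    · intro h; exact absurd h.symm (S.vtx_ne _ _)
    · intro h; exact absurd h.1 (S.not_K z)

theorem q_eq_ψY (hψ : Function.Injective ψ) {x : X} {z : S.F × I01} :
    S.q x = S.ψY z ↔ x = ψ (z.1, z.2) := by
  constructor
  · intro h
    rcases S.K_or x with h' | ⟨z', rfl⟩
    · rw [S.q_K h'] at h; exact absurd h (S.vtx_ne _ _)
    · rw [S.q_edge hψ] at h; rw [S.ψY_inj h]
  · rintro rfl; exact S.q_edge hψ z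

end A

section B

variable {E : Type} [TopologicalSpace E] [DiscreteTopology E] {ψ : E × I01 → X} (S : Stage ψ)

theorem K_closed (hψ : IsOpenEmbedding ψ) : IsClosed S.K := by
  have : S.K = (⋃ i ∈ S.F, edg ψ i)ᶜ := by ext; simp [K]
  rw [this]
  exact (isOpen_biUnion fun i _ => edg_isOpen hψ i).isClosed_compl

theorem V_subset_K : (Set.range ψ)ᶜ ⊆ S.K := by
  rintro x hx i _ ⟨t, ht⟩
  exact hx ⟨_, ht⟩

/-- a preconnected subset of `K` lies in one class -/
theorem p_const {C : Set X} (hC : IsPreconnected C) (hK : C ⊆ S.K) {x y : X} (hx : x ∈ C)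
    (hy : y ∈ C) : S.p x = S.p y := by
  by_contra hne
  have := S.finι
  have h := isPreconnected_closed_iff.1 hC {z | z ∈ S.K ∧ S.p z = S.p x}
    (⋃ b ∈ {b | b ≠ S.p x}, {z | z ∈ S.K ∧ S.p z = b}) (S.closed _)
    ((Set.toFinite _).isClosed_biUnion fun b _ => S.closed b)
    (by
      intro z hz
      by_cases hb : S.p z = S.p x
      · exact Or.inl ⟨hK hz, hb⟩
      · exact Or.inr (Set.mem_biUnion (x := S.p z) hb ⟨hK hz, rfl⟩))
    ⟨x, hx, hK hx, rfl⟩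
    ⟨y, hy, Set.mem_biUnion (x := S.p y) (Ne.symm hne) ⟨hK hy, rfl⟩⟩
  obtain ⟨z, _, ⟨_, h1⟩, h2⟩ := h
  rw [Set.mem_iUnion₂] at h2
  obtain ⟨b, hb, _, h3⟩ := h2
  exact hb (h3.symm.trans h1)

theorem ψY_open (hψ : IsOpenEmbedding ψ) : IsOpenEmbedding S.ψY := by
  have hι : IsOpenEmbedding fun z : S.F × I01 => ((z.1 : E), z.2) :=
    ((isOpen_discrete S.F).isOpenEmbedding_subtypeVal).prodMap IsOpenEmbedding.id
  refine IsOpenEmbedding.of_continuous_injective_isOpenMap ?_ S.ψY_inj ?_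
  · have : S.ψY = S.q ∘ fun z : S.F × I01 => ψ (z.1, z.2) := by
      ext z; exact (S.q_edge hψ.injective z).symm
    rw [this]
    exact S.q_cont.comp (hψ.continuous.comp hι.continuous)
  · intro O hO
    rw [← (S.q_quot hψ.injective).isOpen_preimage]
    have : S.q ⁻¹' (S.ψY '' O) = ψ '' ((fun z : S.F × I01 => ((z.1 : E), z.2)) '' O) := by
      ext x
      constructor
      · rintro ⟨z, hz, h⟩
        exact ⟨_, ⟨z, hz, rfl⟩, ((S.q_eq_ψY hψ.injective).1 h.symm).symm⟩
      · rintro ⟨_, ⟨z, hz, rfl⟩, rfl⟩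
        exact ⟨z, hz, (S.q_edge hψ.injective z).symm⟩
    rw [this]
    exact hψ.isOpenMap _ (hι.isOpenMap _ hO)

theorem range_ψY : Set.range S.ψY = (Set.range S.vtx)ᶜ := by
  ext y
  rcases y with a | z
  · constructor
    · rintro ⟨z, hz⟩; exact absurd hz.symm (S.vtx_ne a z)
    · intro h; exact absurd ⟨a, rfl⟩ h
  · constructor
    · rintro _ ⟨a, ha⟩; exact S.vtx_ne a z ha
    · intro _; exact ⟨z, rfl⟩

end B

end Stage

section Bump

variable {E : Type} [TopologicalSpace E] [DiscreteTopology E] {ψ : E × I01 → X}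

open Classical in
noncomputable def bump (ψ : E × I01 → X) (g : ℝ → ℝ) (i : E) (x : X) : ℝ :=
  if h : ∃ t, ψ (i, t) = x then g (h.choose : I01) else 0

theorem bump_edge (hψ : Function.Injective ψ) (g : ℝ → ℝ) (i : E) (t : I01) :
    bump ψ g i (ψ (i, t)) = g t := by
  unfold bump
  have h : ∃ t', ψ (i, t') = ψ (i, t) := ⟨t, rfl⟩
  rw [dif_pos h]
  have := hψ h.choose_spec
  simp only [Prod.mk.injEq, true_and] at this
  rw [this]

theorem bump_off (g : ℝ → ℝ) (i : E) {x : X} (hx : x ∉ edg ψ i) : bump ψ g i x = 0 := by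
  unfold bump
  rw [dif_neg]
  exact hx

theorem bump_cont [CompactSpace X] [TopologicalSpace.MetrizableSpace X] (hψ : IsOpenEmbedding ψ)
    (g : ℝ → ℝ) (hg : Continuous g) (h0 : g 0 = 0) (h1 : g 1 = 0) (i : E) :
    Continuous (bump ψ g i) := by
  rw [continuous_iff_continuousAt]
  intro x
  by_cases hx : x ∈ edg ψ i
  · obtain ⟨t, rfl⟩ := hx
    rw [← hψ.continuousAt_iff]
    have hev : (fun z : E × I01 => g z.2) =ᶠ[𝓝 (i, t)] (bump ψ g i) ∘ ψ := by
      have : (({i} : Set E) ×ˢ (Set.univ : Set I01)) ∈ 𝓝 (i, t) :=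
        ((isOpen_discrete _).prod isOpen_univ).mem_nhds (by simp)
      filter_upwards [this]
      rintro ⟨j, s⟩ hj
      simp at hj
      subst hj
      exact (bump_edge hψ.injective g j s).symm
    exact ContinuousAt.congr (Continuous.continuousAt (by fun_prop)) hev
  · rw [ContinuousAt, bump_off g i hx, Metric.tendsto_nhds]
    intro ε hε
    let M : Set X := ψ '' (({i} : Set E) ×ˢ (Subtype.val ⁻¹' (Set.Icc 0 1 ∩ {t | ε ≤ |g t|})))
    have hM : IsClosed M := by
      apply IsCompact.isClosed
      refine (isCompact_singleton.prod ?_).image hψ.continuous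
      apply IsInducing.subtypeVal.isCompact_preimage'
      · exact isCompact_Icc.inter_right (isClosed_le continuous_const (by fun_prop))
      · rw [Subtype.range_coe]
        rintro t ⟨⟨ht0, ht1⟩, ht⟩
        simp only [Set.mem_ofPred_eq] at ht
        constructor
        · rcases ht0.eq_or_lt with h | h
          · rw [← h, h0] at ht; simp at ht; linarith
          · exact h
        · rcases ht1.eq_or_lt with h | h
          · rw [h, h1] at ht; simp at ht; linarith
          · exact h
    have hxM : x ∈ Mᶜ := by
      rintro ⟨⟨j, t⟩, ⟨hj, _⟩, rfl⟩
      simp at hj; subst hj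
      exact hx ⟨t, rfl⟩
    filter_upwards [hM.isOpen_compl.mem_nhds hxM] with y hy
    rw [Real.dist_eq, sub_zero]
    by_cases hye : y ∈ edg ψ i
    · obtain ⟨t, rfl⟩ := hye
      rw [bump_edge hψ.injective]
      by_contra hcon
      exact hy ⟨(i, t), ⟨rfl, ⟨t.2.1.le, t.2.2.le⟩, not_lt.1 hcon⟩, rfl⟩
    · rw [bump_off g i hye]; simpa using hε

end Bump

namespace Stage

variable {E : Type} [TopologicalSpace E] [DiscreteTopology E] {ψ : E × I01 → X} (S : Stage ψ)
  [CompactSpace X] [TopologicalSpace.MetrizableSpace X]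

theorem exists_ury (a : S.ι) : ∃ f : X → ℝ, Continuous f ∧ ∀ x ∈ S.K,
    (S.p x = a → f x = 0) ∧ (S.p x ≠ a → f x = 1) := by
  have := S.finι
  obtain ⟨f, hf0, hf1, _⟩ := exists_continuous_zero_one_of_isClosed (S.closed a)
    (t := ⋃ b ∈ {b | b ≠ a}, {z | z ∈ S.K ∧ S.p z = b})
    ((Set.toFinite _).isClosed_biUnion fun b _ => S.closed b)
    (by
      rw [Set.disjoint_iUnion₂_right]
      intro b hb
      rw [Set.disjoint_left]
      rintro x ⟨_, h1⟩ ⟨_, h2⟩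
      exact hb (h2.symm.trans h1))
  refine ⟨f, f.continuous, fun x hx => ⟨fun h => hf0 ⟨hx, h⟩, fun h => hf1 ?_⟩⟩
  exact Set.mem_biUnion (x := S.p x) h ⟨hx, rfl⟩

theorem metrizable (hψ : IsOpenEmbedding ψ) : CompactSpace S.Y ∧
    TopologicalSpace.MetrizableSpace S.Y := by
  have hq := S.q_quot hψ.injective
  have hc : CompactSpace S.Y := by
    have := isCompact_range S.q_cont
    rw [hq.surjective.range_eq] at this
    exact ⟨this⟩
  refine ⟨hc, ?_⟩
  have := S.finι
  have := S.finF.to_subtype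
  have := Fintype.ofFinite S.ι
  have := Fintype.ofFinite S.F
  choose f hf hfK using S.exists_ury
  let g1 : ℝ → ℝ := fun t => t * (1 - t)
  let g2 : ℝ → ℝ := fun t => t * (t * (1 - t))
  let Φ : X → (S.ι → ℝ) × (S.F → ℝ) × (S.F → ℝ) := fun x =>
    (fun a => f a x, fun i => bump ψ g1 i x, fun i => bump ψ g2 i x)
  have hΦ : Continuous Φ := by
    refine Continuous.prodMk (continuous_pi fun a => hf a)
      (Continuous.prodMk (continuous_pi fun i => ?_) (continuous_pi fun i => ?_))
    · exact bump_cont hψ g1 (by fun_prop) (by simp [g1]) (by simp [g1]) _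
    · exact bump_cont hψ g2 (by fun_prop) (by simp [g2]) (by simp [g2]) _
  have hb1 : ∀ (z : S.F × I01), 0 < bump ψ g1 z.1 (ψ (z.1, z.2)) := by
    intro z
    rw [bump_edge hψ.injective]
    exact mul_pos z.2.2.1 (by linarith [z.2.2.2])
  have hb2 : ∀ (z : S.F × I01) x, bump ψ g1 z.1 (ψ (z.1, z.2)) = bump ψ g1 z.1 x →
      bump ψ g2 z.1 (ψ (z.1, z.2)) = bump ψ g2 z.1 x → x = ψ (z.1, z.2) := by
    intro z x h1 h2
    by_cases hx : x ∈ edg ψ z.1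
    · obtain ⟨t, rfl⟩ := hx
      simp only [bump_edge hψ.injective] at h1 h2
      have hp : 0 < g1 z.2 := mul_pos z.2.2.1 (by linarith [z.2.2.2])
      change z.2.1 * g1 z.2 = t.1 * g1 t at h2
      rw [← h1] at h2
      have : z.2 = t := Subtype.ext (mul_right_cancel₀ hp.ne' h2)
      rw [this]
    · rw [bump_off g1 _ hx] at h1
      have := hb1 z
      rw [h1] at this
      exact absurd this (lt_irrefl _)
  have hΦq : ∀ x y, S.q x = S.q y ↔ Φ x = Φ y := by
    intro x y
    constructor
    · intro h
      rcases S.K_or x with hx | ⟨z, rfl⟩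
      · rw [S.q_K hx] at h
        obtain ⟨hy, hp⟩ := (S.q_eq_vtx hψ.injective).1 h.symm
        refine Prod.ext ?_ (Prod.ext ?_ ?_)
        · funext a
          by_cases ha : S.p x = a
          · exact ((hfK a x hx).1 ha).trans ((hfK a y hy).1 (hp.trans ha)).symm
          · exact ((hfK a x hx).2 ha).trans ((hfK a y hy).2 (hp ▸ ha)).symm
        · funext i
          exact (bump_off g1 _ (hx i i.2)).trans (bump_off g1 _ (hy i i.2)).symm
        · funext i
          exact (bump_off g2 _ (hx i i.2)).trans (bump_off g2 _ (hy i i.2)).symm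
      · rw [S.q_edge hψ.injective] at h
        rw [(S.q_eq_ψY hψ.injective).1 h.symm]
    · intro h
      have e0 : ∀ a, f a x = f a y := fun a => congrFun (congrArg Prod.fst h) a
      have e1 : ∀ i : S.F, bump ψ g1 i x = bump ψ g1 i y :=
        fun a => congrFun (congrArg (fun w => w.2.1) h) a
      have e2 : ∀ i : S.F, bump ψ g2 i x = bump ψ g2 i y :=
        fun a => congrFun (congrArg (fun w => w.2.2) h) a
      rcases S.K_or x with hx | ⟨z, rfl⟩
      · rcases S.K_or y with hy | ⟨z, rfl⟩
        · rw [S.q_K hx, S.q_K hy]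
          congr 1
          by_contra hne
          have h3 := e0 (S.p y)
          rw [(hfK _ x hx).2 hne, (hfK _ y hy).1 rfl] at h3
          exact one_ne_zero h3
        · rw [hb2 z x (e1 _).symm (e2 _).symm]
      · rw [hb2 z y (e1 _) (e2 _)]
  let Φ' : S.Y → (S.ι → ℝ) × (S.F → ℝ) × (S.F → ℝ) := fun y => Φ (surjInv hq.surjective y)
  have hcomp : Φ' ∘ S.q = Φ := by
    funext x
    exact (hΦq _ _).1 (surjInv_eq hq.surjective _)
  have hcont : Continuous Φ' := hq.continuous_iff.2 (hcomp ▸ hΦ)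
  have hinj : Function.Injective Φ' := by
    intro a b h
    have := (hΦq _ _).2 h
    rwa [surjInv_eq hq.surjective, surjInv_eq hq.surjective] at this
  exact (hcont.isClosedEmbedding hinj).isEmbedding.metrizableSpace

end Stage

namespace Stage

variable {E : Type} [TopologicalSpace E] [DiscreteTopology E] {ψ : E × I01 → X} (S : Stage ψ)
  [CompactSpace X] [TopologicalSpace.MetrizableSpace X]

theorem V_preimage (hψ : IsOpenEmbedding ψ) : S.q ⁻¹' (Set.range S.vtx) = S.K := by
  ext x
  constructor
  · rintro ⟨a, ha⟩; exact ((S.q_eq_vtx hψ.injective).1 ha.symm).1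
  · intro h; exact ⟨_, (S.q_K h).symm⟩

theorem homeo_aux (hψ : IsOpenEmbedding ψ) :
    Nonempty (((Set.range S.vtx)ᶜ : Set S.Y) ≃ₜ (S.F × I01)) := by
  have h := (S.ψY_open hψ).toIsEmbedding.toHomeomorph
  rw [S.range_ψY] at h
  exact ⟨h.symm⟩

def gl (hψ : IsOpenEmbedding ψ) : GraphLike S.Y where
  V := Set.range S.vtx
  closedV := by
    rw [← (S.q_quot hψ.injective).isClosed_preimage, S.V_preimage hψ]
    exact S.K_closed hψ
  zeroDimV := by
    have := (S.metrizable hψ).2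
    have := S.finι
    have : Finite (Set.range S.vtx) := inferInstance
    infer_instance
  E := S.F
  homeo := by
    have h : (⊥ : TopologicalSpace S.F) = instTopologicalSpaceSubtype :=
      (DiscreteTopology.eq_bot).symm
    have := S.homeo_aux hψ
    rw [← h] at this
    exact this

noncomputable def TG (hψ : IsOpenEmbedding ψ) : TopGraphLike :=
  { carrier := S.Y
    topology := inferInstance
    compact := (S.metrizable hψ).1
    metrizable := (S.metrizable hψ).2
    gl := S.gl hψ }

theorem gl_range (hψ : IsOpenEmbedding ψ) : Set.range S.ψY = (S.gl hψ).Vᶜ := S.range_ψY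

theorem TG_finite (hψ : IsOpenEmbedding ψ) : (S.TG hψ).IsFiniteMultiGraph := by
  have := S.finι
  have := S.finF.to_subtype
  refine ⟨Set.finite_range S.vtx, ?_⟩
  refine (Set.finite_range (edg S.ψY)).subset ?_
  intro e he
  obtain ⟨i, hi⟩ := (isEdge_iff (S.ψY_open hψ) (S.gl hψ) (S.gl_range hψ) e).1 he
  exact ⟨i, hi.symm⟩

theorem closure_subset_K (hψ : IsOpenEmbedding ψ) {i : E} (hi : i ∉ S.F) :
    closure (edg ψ i) ⊆ S.K := by
  intro x hx
  by_cases hr : x ∈ Set.range ψ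
  · intro j hj hxj
    have hxi := closure_edg hψ i hx hr
    exact Set.disjoint_left.1 (edg_disjoint hψ (fun h : i = j => hi (h ▸ hj))) hxi hxj
  · exact S.V_subset_K hr

theorem edg_image (hψ : IsOpenEmbedding ψ) (i : S.F) : edg S.ψY i = S.q '' edg ψ i := by
  unfold edg
  rw [← Set.range_comp]
  congr 1
  funext t
  exact (S.q_edge hψ.injective (i, t)).symm

theorem closure_edg_image (hψ : IsOpenEmbedding ψ) (i : S.F) :
    closure (edg S.ψY i) = S.q '' closure (edg ψ i) := by
  have := (S.metrizable hψ).2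
  rw [edg_image S hψ]
  exact S.q_cont.isClosedMap.closure_image_eq_of_continuous S.q_cont _

/-- cut determined by a set of classes -/
def bcut (B : Set S.ι) : Set E :=
  icut ψ ((Set.range ψ)ᶜ ∩ S.p ⁻¹' B) ((Set.range ψ)ᶜ ∩ S.p ⁻¹' Bᶜ)

theorem meets_iff (hψ : IsOpenEmbedding ψ) (i : S.F) (B : Set S.ι) :
    (closure (edg S.ψY i) ∩ S.vtx '' B).Nonempty ↔
      (closure (edg ψ i) ∩ ((Set.range ψ)ᶜ ∩ S.p ⁻¹' B)).Nonempty := by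
  rw [closure_edg_image S hψ]
  constructor
  · rintro ⟨_, ⟨x, hx, rfl⟩, b, hb, hxb⟩
    obtain ⟨hK, rfl⟩ := (S.q_eq_vtx hψ.injective).1 hxb.symm
    refine ⟨x, hx, fun hr => ?_, hb⟩
    exact hK i i.2 (closure_edg hψ i hx hr)
  · rintro ⟨x, hx, hV, hB⟩
    exact ⟨_, ⟨x, hx, rfl⟩, S.p x, hB, (S.q_K (S.V_subset_K hV)).symm⟩

theorem evenCut_vtx (hψ : IsOpenEmbedding ψ) (a : S.ι) (hsub : S.bcut {a} ⊆ S.F) :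
    (S.gl hψ).EvenCut {S.vtx a} ((S.gl hψ).V \ {S.vtx a}) ↔ Even (S.bcut {a}).ncard := by
  rw [evenCut_iff (S.ψY_open hψ) (S.gl hψ) (S.gl_range hψ)]
  have h1 : ({S.vtx a} : Set S.Y) = S.vtx '' {a} := by simp
  have h2 : (S.gl hψ).V \ {S.vtx a} = S.vtx '' {a}ᶜ := by
    rw [Set.image_compl_eq_range_sdiff_image S.vtx_inj]
    simp [gl]
  have h3 : icut S.ψY {S.vtx a} ((S.gl hψ).V \ {S.vtx a}) = Subtype.val ⁻¹' S.bcut {a} := by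
    ext i
    rw [h2, h1]
    unfold icut bcut
    simp only [Set.mem_ofPred_eq, Set.mem_preimage]
    rw [S.meets_iff hψ, S.meets_iff hψ]
    rfl
  rw [h3]
  have h4 : (Subtype.val ⁻¹' S.bcut {a} : Set S.F).ncard = (S.bcut {a}).ncard := by
    rw [← Set.ncard_image_of_injective _ Subtype.val_injective, Subtype.image_preimage_coe,
      Set.inter_eq_right.2 hsub]
  rw [h4]
  have := S.finF.to_subtype
  exact ⟨fun h => h.2, fun h => ⟨Set.toFinite _, h⟩⟩

section parity

variable (s t : E → X) (hs : ∀ i, s i ∉ Set.range ψ) (ht : ∀ i, t i ∉ Set.range ψ)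
  (hst : ∀ i x, x ∉ Set.range ψ → (x ∈ closure (edg ψ i) ↔ x = s i ∨ x = t i))

include hs ht hst

theorem mem_bcut (B : Set S.ι) (i : E) :
    i ∈ S.bcut B ↔ ¬ (S.p (s i) ∈ B ↔ S.p (t i) ∈ B) := by
  have key : ∀ C : Set S.ι, (closure (edg ψ i) ∩ ((Set.range ψ)ᶜ ∩ S.p ⁻¹' C)).Nonempty ↔
      S.p (s i) ∈ C ∨ S.p (t i) ∈ C := by
    intro C
    constructor
    · rintro ⟨x, hx, hV, hC⟩
      rcases (hst i x hV).1 hx with rfl | rfl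
      · exact Or.inl hC
      · exact Or.inr hC
    · rintro (h | h)
      · exact ⟨s i, (hst i _ (hs i)).2 (Or.inl rfl), hs i, h⟩
      · exact ⟨t i, (hst i _ (ht i)).2 (Or.inr rfl), ht i, h⟩
  unfold bcut icut
  simp only [Set.mem_ofPred_eq]
  rw [key, key]
  simp only [Set.mem_compl_iff]
  tauto

theorem bcut_sub (hψ : IsOpenEmbedding ψ) (B : Set S.ι) : S.bcut B ⊆ S.F := by
  intro i hi
  by_contra hiF
  rw [mem_bcut S s t hs ht hst] at hi
  apply hi
  rw [S.p_const (edg_preconnected hψ i).closure (S.closure_subset_K hψ hiF)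
    ((hst i _ (hs i)).2 (Or.inl rfl)) ((hst i _ (ht i)).2 (Or.inr rfl))]

open Classical in
theorem bcut_card (hψ : IsOpenEmbedding ψ) (B : Set S.ι) :
    ((S.bcut B).ncard : ZMod 2) = ∑ i ∈ S.finF.toFinset,
      ((if S.p (s i) ∈ B then 1 else 0) + (if S.p (t i) ∈ B then 1 else 0)) := by
  have h1 : S.bcut B = ↑(S.finF.toFinset.filter (fun i => i ∈ S.bcut B)) := by
    ext i
    simp only [Finset.coe_filter, Set.Finite.mem_toFinset, Set.mem_ofPred_eq]
    exact ⟨fun h => ⟨S.bcut_sub s t hs ht hst hψ B h, h⟩, fun h => h.2⟩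
  rw [h1, Set.ncard_coe_finset, Finset.card_filter]
  push_cast
  refine Finset.sum_congr rfl fun i _ => ?_
  have := mem_bcut S s t hs ht hst B i
  by_cases hsB : S.p (s i) ∈ B <;> by_cases htB : S.p (t i) ∈ B <;> simp [this, hsB, htB]
  decide

theorem bcut_even (hψ : IsOpenEmbedding ψ) (h : ∀ a, Even (S.bcut {a}).ncard) (B : Set S.ι) :
    Even (S.bcut B).ncard := by
  classical
  have := S.finι
  have := Fintype.ofFinite S.ι
  rw [← ZMod.natCast_eq_zero_iff_even, S.bcut_card s t hs ht hst hψ]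
  have h2 : ∀ a, ((S.bcut {a}).ncard : ZMod 2) = 0 := fun a =>
    (ZMod.natCast_eq_zero_iff_even).2 (h a)
  have h3 : ∀ c : S.ι, (if c ∈ B then (1 : ZMod 2) else 0) =
      ∑ a ∈ B.toFinset, if c ∈ ({a} : Set S.ι) then 1 else 0 := by
    intro c
    simp
  simp only [h3, ← Finset.sum_add_distrib]
  rw [Finset.sum_comm]
  apply Finset.sum_eq_zero
  intro a _
  have h5 := S.bcut_card s t hs ht hst hψ {a}
  rw [h2 a] at h5
  convert h5.symm

end parity

end Stage

structure Tower {X : Type u} [TopologicalSpace X] {E : Type} {ψ : E × I01 → X}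
    (S : ℕ → Stage ψ) : Prop where
  mono : ∀ n, (S n).F ⊆ (S (n + 1)).F
  ref : ∀ n x y, x ∈ (S (n + 1)).K → y ∈ (S (n + 1)).K →
    (S (n + 1)).p x = (S (n + 1)).p y → (S n).p x = (S n).p y
  exh : ∀ i, ∃ n, i ∈ (S n).F
  sep : ∀ x y, x ∉ Set.range ψ → y ∉ Set.range ψ → x ≠ y → ∃ n, (S n).p x ≠ (S n).p y

namespace Tower

variable {E : Type} [TopologicalSpace E] [DiscreteTopology E] {ψ : E × I01 → X} {S : ℕ → Stage ψ}
  [CompactSpace X] [TopologicalSpace.MetrizableSpace X]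

theorem K_mono (T : Tower S) (n : ℕ) : (S (n + 1)).K ⊆ (S n).K :=
  fun _ hx i hi => hx i (T.mono n hi)

theorem q_ref (T : Tower S) (hψ : IsOpenEmbedding ψ) (n : ℕ) {x y : X}
    (h : (S (n + 1)).q x = (S (n + 1)).q y) : (S n).q x = (S n).q y := by
  rcases (S (n+1)).K_or x with hx | ⟨z, rfl⟩
  · rw [(S (n+1)).q_K hx] at h
    obtain ⟨hy, hp⟩ := ((S (n+1)).q_eq_vtx hψ.injective).1 h.symm
    rw [(S n).q_K (T.K_mono n hx), (S n).q_K (T.K_mono n hy), T.ref n x y hx hy hp.symm]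
  · rw [(S (n+1)).q_edge hψ.injective] at h
    rw [((S (n+1)).q_eq_ψY hψ.injective).1 h.symm]

theorem q_sep (T : Tower S) (hψ : IsOpenEmbedding ψ) {x y : X}
    (h : ∀ n, (S n).q x = (S n).q y) : x = y := by
  by_cases hx : x ∈ Set.range ψ
  · obtain ⟨⟨i, t⟩, rfl⟩ := hx
    obtain ⟨n, hn⟩ := T.exh i
    have := h n
    rw [(S n).q_edge hψ.injective (⟨i, hn⟩, t)] at this
    exact (((S n).q_eq_ψY hψ.injective).1 this.symm).symm
  by_cases hy : y ∈ Set.range ψ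
  · obtain ⟨⟨i, t⟩, rfl⟩ := hy
    obtain ⟨n, hn⟩ := T.exh i
    have := h n
    rw [(S n).q_edge hψ.injective (⟨i, hn⟩, t)] at this
    exact (((S n).q_eq_ψY hψ.injective).1 this)
  by_contra hne
  obtain ⟨n, hn⟩ := T.sep x y hx hy hne
  have := h n
  rw [(S n).q_K ((S n).V_subset_K hx), (S n).q_K ((S n).V_subset_K hy)] at this
  exact hn ((S n).vtx_inj this)

theorem compactness (T : Tower S) (hψ : IsOpenEmbedding ψ) {A B : Set X} (hA : IsClosed A)
    (hB : IsClosed B) (hd : Disjoint A B) :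
    ∃ n, ∀ x ∈ A, ∀ y ∈ B, (S n).q x ≠ (S n).q y := by
  by_contra hcon
  push Not at hcon
  have hcl : ∀ n, IsClosed ((A ×ˢ B) ∩ {z : X × X | (S n).q z.1 = (S n).q z.2}) := by
    intro n
    have := ((S n).metrizable hψ).2
    exact (hA.prod hB).inter (isClosed_eq ((S n).q_cont.comp continuous_fst)
      ((S n).q_cont.comp continuous_snd))
  obtain ⟨⟨x, y⟩, h⟩ := IsCompact.nonempty_iInter_of_sequence_nonempty_isCompact_isClosed
    (fun n : ℕ => (A ×ˢ B) ∩ {z : X × X | (S n).q z.1 = (S n).q z.2})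
    (fun n => Set.inter_subset_inter_right _ fun z hz => T.q_ref hψ n hz)
    (fun n => by
      obtain ⟨x, hx, y, hy, h⟩ := hcon n
      exact ⟨(x, y), ⟨hx, hy⟩, h⟩) (hcl 0).isCompact hcl
  rw [Set.mem_iInter] at h
  have hxy : x = y := T.q_sep hψ fun n => (h n).2
  subst hxy
  exact Set.disjoint_left.1 hd (h 0).1.1 (h 0).1.2

noncomputable def bond (hψ : IsOpenEmbedding ψ) (n : ℕ) (y : (S (n + 1)).Y) : (S n).Y :=
  (S n).q (surjInv ((S (n + 1)).q_surj hψ.injective) y)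

theorem bond_q (T : Tower S) (hψ : IsOpenEmbedding ψ) (n : ℕ) (x : X) :
    bond hψ n ((S (n + 1)).q x) = (S n).q x :=
  T.q_ref hψ n (surjInv_eq _ _)

theorem bond_cont (T : Tower S) (hψ : IsOpenEmbedding ψ) (n : ℕ) :
    Continuous (bond (S := S) hψ n) := by
  rw [((S (n+1)).q_quot hψ.injective).continuous_iff]
  have : bond (S := S) hψ n ∘ (S (n+1)).q = (S n).q := funext fun x => T.bond_q hψ n x
  rw [this]
  exact (S n).q_cont

theorem bond_surj (T : Tower S) (hψ : IsOpenEmbedding ψ) (n : ℕ) :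
    Function.Surjective (bond (S := S) hψ n) := by
  intro y
  obtain ⟨x, rfl⟩ := (S n).q_surj hψ.injective y
  exact ⟨_, T.bond_q hψ n x⟩

theorem bond_preimage (T : Tower S) (hψ : IsOpenEmbedding ψ) (n : ℕ) (y : (S n).Y) :
    (bond (S := S) hψ n) ⁻¹' {y} = (S (n + 1)).q '' ((S n).q ⁻¹' {y}) := by
  ext w
  obtain ⟨x, rfl⟩ := (S (n+1)).q_surj hψ.injective w
  constructor
  · intro h
    rw [Set.mem_preimage, T.bond_q hψ n] at h
    exact ⟨x, h, rfl⟩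
  · rintro ⟨x', hx', h⟩
    rw [← h, Set.mem_preimage, T.bond_q hψ n]
    exact hx'

theorem bond_simplicial (T : Tower S) (hψ : IsOpenEmbedding ψ) (n : ℕ) :
    Simplicial ((S (n + 1)).gl hψ) ((S n).gl hψ) (bond (S := S) hψ n) := by
  refine ⟨T.bond_cont hψ n, ?_, ?_⟩
  · rintro _ ⟨a, rfl⟩
    obtain ⟨x, hx, rfl⟩ := (S (n+1)).surj a
    rw [← (S (n+1)).q_K hx, T.bond_q hψ n, (S n).q_K (T.K_mono n hx)]
    exact ⟨_, rfl⟩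
  · intro e he
    obtain ⟨i, rfl⟩ := (isEdge_iff ((S (n+1)).ψY_open hψ) _ ((S (n+1)).gl_range hψ) e).1 he
    by_cases hi : (i : E) ∈ (S n).F
    · right
      have hval : ∀ t, bond (S := S) hψ n ((S (n+1)).ψY (i, t)) = (S n).ψY (⟨i, hi⟩, t) := by
        intro t
        rw [← (S (n+1)).q_edge hψ.injective, T.bond_q hψ n]
        exact (S n).q_edge hψ.injective (⟨i, hi⟩, t)
      have himg : bond (S := S) hψ n '' edg (S (n+1)).ψY i = edg (S n).ψY ⟨i, hi⟩ := by
        unfold edg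
        rw [← Set.range_comp]
        congr 1
        funext t
        exact hval t
      refine ⟨(isEdge_iff ((S n).ψY_open hψ) _ ((S n).gl_range hψ) _).2 ⟨_, himg⟩, ?_⟩
      have emb : ∀ (m : ℕ) (j : (S m).F), IsEmbedding fun t : I01 => (S m).ψY (j, t) := by
        intro m j
        exact ((S m).ψY_open hψ).isEmbedding.comp (isEmbedding_prodMkRight j)
      let h1 : I01 ≃ₜ edg (S (n+1)).ψY i := (emb (n+1) i).toHomeomorph
      let h0 : I01 ≃ₜ edg (S n).ψY ⟨i, hi⟩ := (emb n ⟨i, hi⟩).toHomeomorph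
      refine ⟨h1.symm.trans (h0.trans (Homeomorph.setCongr himg.symm)), ?_⟩
      intro x
      obtain ⟨t, rfl⟩ := h1.surjective x
      simp only [Homeomorph.trans_apply, Homeomorph.symm_apply_apply]
      exact (hval t).symm
    · left
      have hsub : edg ψ i ⊆ (S n).K := subset_closure.trans ((S n).closure_subset_K hψ hi)
      obtain ⟨x, hx⟩ := edg_nonempty (ψ := ψ) (i : E)
      refine ⟨(S n).vtx ((S n).p x), ⟨_, rfl⟩, ?_⟩
      rw [(S (n+1)).edg_image hψ, ← Set.image_comp]
      ext y
      constructor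
      · rintro ⟨x', hx', rfl⟩
        rw [Function.comp_apply, T.bond_q hψ n, (S n).q_K (hsub hx'),
          (S n).p_const (edg_preconnected hψ i) hsub hx' hx]
        rfl
      · rintro rfl
        exact ⟨x, hx, by rw [Function.comp_apply, T.bond_q hψ n, (S n).q_K (hsub hx)]⟩

theorem bond_fib (T : Tower S) (hψ : IsOpenEmbedding ψ) (n : ℕ) (y : (S n).Y)
    (hy : y ∉ Set.range (S n).vtx) : ((bond (S := S) hψ n) ⁻¹' {y}).Subsingleton := by
  have : y ∈ Set.range (S n).ψY := by rw [(S n).range_ψY]; exact hy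
  obtain ⟨z, rfl⟩ := this
  rw [T.bond_preimage hψ]
  apply Set.Subsingleton.image
  intro a ha b hb
  rw [((S n).q_eq_ψY hψ.injective).1 ha, ((S n).q_eq_ψY hψ.injective).1 hb]

theorem bond_mono (T : Tower S) (hψ : IsOpenEmbedding ψ)
    (hc : ∀ n a, IsPreconnected {x | x ∈ (S n).K ∧ (S n).p x = a}) (n : ℕ) (y : (S n).Y) :
    IsPreconnected ((bond (S := S) hψ n) ⁻¹' {y}) := by
  by_cases hy : y ∈ Set.range (S n).vtx
  · obtain ⟨a, rfl⟩ := hy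
    rw [T.bond_preimage hψ]
    refine IsPreconnected.image ?_ _ (S (n+1)).q_cont.continuousOn
    convert hc n a using 1
    ext x
    exact (S n).q_eq_vtx hψ.injective
  · exact (T.bond_fib hψ n y hy).isPreconnected

theorem connected_iff (T : Tower S) (hψ : IsOpenEmbedding ψ) :
    ConnectedSpace X ↔ ∀ n, ConnectedSpace (S n).Y := by
  constructor
  · intro h n
    exact ((S n).q_surj hψ.injective).connectedSpace (S n).q_cont
  · intro h
    have hne : Nonempty X := by
      obtain ⟨y⟩ := (h 0).toNonempty
      exact ⟨((S 0).q_surj hψ.injective y).choose⟩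
    have hpre : PreconnectedSpace X := by
      rw [preconnectedSpace_iff_clopen]
      intro C hC
      obtain ⟨n, hn⟩ := T.compactness hψ hC.isClosed hC.compl.isClosed disjoint_compl_right
      have hsat : (S n).q ⁻¹' ((S n).q '' C) = C := by
        apply Set.Subset.antisymm _ (Set.subset_preimage_image _ _)
        rintro x ⟨y, hy, hxy⟩
        by_contra hx
        exact hn y hy x hx hxy
      have hcl : IsClopen ((S n).q '' C) := by
        constructor
        · rw [← ((S n).q_quot hψ.injective).isClosed_preimage, hsat]; exact hC.isClosed
        · rw [← ((S n).q_quot hψ.injective).isOpen_preimage, hsat]; exact hC.isOpen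
      have := h n
      rcases isClopen_iff.1 hcl with h0 | h0
      · left; exact Set.image_eq_empty.1 h0
      · right; rw [← hsat, h0, Set.preimage_univ]
    exact ⟨hne⟩

theorem even_iff (T : Tower S) (hψ : IsOpenEmbedding ψ) (G : GraphLike X)
    (hr : Set.range ψ = G.Vᶜ) :
    (∀ P : G.Separation, G.EvenCut P.A P.B) ↔
      ∀ n, ∀ v ∈ ((S n).gl hψ).V, ((S n).gl hψ).EvenCut {v} (((S n).gl hψ).V \ {v}) := by
  have hV : G.V = (Set.range ψ)ᶜ := by rw [hr, compl_compl]
  have hT : TotallyDisconnectedSpace ((Set.range ψ)ᶜ : Set X) := hV ▸ G.zeroDimV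
  choose s t hs ht hst using exists_ends hψ hT
  have hcl : ∀ n (B : Set (S n).ι), IsClosed ((Set.range ψ)ᶜ ∩ (S n).p ⁻¹' B) := by
    intro n B
    have := (S n).finι
    have h2 : (Set.range ψ)ᶜ ∩ (S n).p ⁻¹' B =
        (Set.range ψ)ᶜ ∩ ⋃ b ∈ B, {z | z ∈ (S n).K ∧ (S n).p z = b} := by
      ext x
      constructor
      · rintro ⟨h1, h2⟩
        exact ⟨h1, Set.mem_biUnion (x := (S n).p x) h2 ⟨(S n).V_subset_K h1, rfl⟩⟩
      · rintro ⟨h1, h2⟩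
        rw [Set.mem_iUnion₂] at h2
        obtain ⟨b, hb, _, rfl⟩ := h2
        exact ⟨h1, hb⟩
    rw [h2]
    exact (vclosed hψ).inter ((Set.toFinite _).isClosed_biUnion fun b _ => (S n).closed b)
  constructor
  · rintro h n _ ⟨a, rfl⟩
    rw [(S n).evenCut_vtx hψ a ((S n).bcut_sub s t hs ht hst hψ _)]
    let A := (Set.range ψ)ᶜ ∩ (S n).p ⁻¹' {a}
    let B := (Set.range ψ)ᶜ ∩ (S n).p ⁻¹' {a}ᶜ
    have hAB : A ∩ B = ∅ := by
      ext x; simp only [A, B, Set.mem_inter_iff, Set.mem_preimage, Set.mem_compl_iff,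
        Set.mem_empty_iff_false]; tauto
    have hU : A ∪ B = G.V := by
      rw [hV, ← Set.inter_union_distrib_left, ← Set.preimage_union, Set.union_compl_self]
      simp
    have hdA : G.V \ A = B := by
      rw [← hU, Set.union_sdiff_left, sdiff_eq_left, Set.disjoint_iff_inter_eq_empty,
        Set.inter_comm]
      exact hAB
    have hdB : G.V \ B = A := by
      rw [← hU, Set.union_sdiff_right, sdiff_eq_left, Set.disjoint_iff_inter_eq_empty]
      exact hAB
    let P : G.Separation :=
      { A := A, B := B
        clopenA := ⟨hU ▸ Set.subset_union_left, hcl n _, hdA ▸ hcl n _⟩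
        clopenB := ⟨hU ▸ Set.subset_union_right, hcl n _, hdB ▸ hcl n _⟩
        disjoint := hAB
        union := hU }
    exact ((evenCut_iff hψ G hr _ _).1 (h P)).2
  · intro h P
    rw [evenCut_iff hψ G hr]
    have hd : Disjoint P.A P.B := Set.disjoint_iff_inter_eq_empty.2 P.disjoint
    obtain ⟨n, hn⟩ := T.compactness hψ P.clopenA.2.1 P.clopenB.2.1 hd
    have hAV : ∀ x ∈ P.A, x ∉ Set.range ψ := fun x hx => by
      have := P.clopenA.1 hx; rwa [hV] at this
    have hBV : ∀ x ∈ P.B, x ∉ Set.range ψ := fun x hx => by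
      have := P.clopenB.1 hx; rwa [hV] at this
    have hne : ∀ x ∈ P.A, ∀ y ∈ P.B, (S n).p x ≠ (S n).p y := by
      intro x hx y hy hxy
      apply hn x hx y hy
      rw [(S n).q_K ((S n).V_subset_K (hAV x hx)), (S n).q_K ((S n).V_subset_K (hBV y hy)), hxy]
    have hor : ∀ x, x ∉ Set.range ψ → x ∈ P.A ∨ x ∈ P.B := by
      intro x hx
      have : x ∈ P.A ∪ P.B := by rw [P.union, hV]; exact hx
      exact this
    have hA : P.A = (Set.range ψ)ᶜ ∩ (S n).p ⁻¹' ((S n).p '' P.A) := by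
      ext x
      constructor
      · intro hx; exact ⟨hAV x hx, x, hx, rfl⟩
      · rintro ⟨hx, y, hy, hxy⟩
        rcases hor x hx with h1 | h1
        · exact h1
        · exact absurd hxy (hne y hy x h1)
    have hB : P.B = (Set.range ψ)ᶜ ∩ (S n).p ⁻¹' ((S n).p '' P.A)ᶜ := by
      ext x
      constructor
      · rintro hx
        refine ⟨hBV x hx, ?_⟩
        rintro ⟨y, hy, hxy⟩
        exact hne y hy x hx hxy
      · rintro ⟨hx, hx2⟩
        rcases hor x hx with h1 | h1
        · exact absurd ⟨x, h1, rfl⟩ hx2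
        · exact h1
    have hc : icut ψ P.A P.B = (S n).bcut ((S n).p '' P.A) := by
      unfold Stage.bcut
      rw [← hA, ← hB]
    rw [hc]
    refine ⟨(S n).finF.subset ((S n).bcut_sub s t hs ht hst hψ _), ?_⟩
    apply (S n).bcut_even s t hs ht hst hψ
    intro a
    rw [← (S n).evenCut_vtx hψ a ((S n).bcut_sub s t hs ht hst hψ _)]
    exact h n _ ⟨a, rfl⟩

theorem limit_homeo (T : Tower S) (hψ : IsOpenEmbedding ψ) :
    Nonempty (X ≃ₜ {x : ∀ n, (S n).Y // ∀ n, bond (S := S) hψ n (x (n + 1)) = x n}) := by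
  have hm : ∀ n, TopologicalSpace.MetrizableSpace (S n).Y := fun n => ((S n).metrizable hψ).2
  let g : X → {x : ∀ n, (S n).Y // ∀ n, bond (S := S) hψ n (x (n + 1)) = x n} :=
    fun x => ⟨fun n => (S n).q x, fun n => T.bond_q hψ n x⟩
  have hg : Continuous g := by
    apply Continuous.subtype_mk
    exact continuous_pi fun n => (S n).q_cont
  have hinj : Function.Injective g := by
    intro x y h
    apply T.q_sep hψ
    intro n
    exact congrFun (congrArg Subtype.val h) n
  have hsurj : Function.Surjective g := by
    rintro ⟨y, hy⟩
    obtain ⟨x, hx⟩ := IsCompact.nonempty_iInter_of_sequence_nonempty_isCompact_isClosed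
      (fun n : ℕ => (S n).q ⁻¹' {y n})
      (fun n x hx => by
        simp only [Set.mem_preimage, Set.mem_singleton_iff] at hx ⊢
        rw [← T.bond_q hψ n, hx, hy])
      (fun n => (S n).q_surj hψ.injective (y n))
      ((isClosed_singleton.preimage (S 0).q_cont).isCompact)
      (fun n => isClosed_singleton.preimage (S n).q_cont)
    rw [Set.mem_iInter] at hx
    exact ⟨x, Subtype.ext (funext fun n => hx n)⟩
  exact ⟨Continuous.homeoOfEquivCompactToT2 (f := Equiv.ofBijective g ⟨hinj, hsurj⟩) hg⟩

theorem main (T : Tower S) (hψ : IsOpenEmbedding ψ) (G : GraphLike X)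
    (hr : Set.range ψ = G.Vᶜ)
    (hc : ConnectedSpace X → ∀ n a, IsPreconnected {x | x ∈ (S n).K ∧ (S n).p x = a}) :
    ∃ (Y : ℕ → TopGraphLike) (f : ∀ n, (Y (n + 1)).carrier → (Y n).carrier),
      (∀ n, (Y n).IsFiniteMultiGraph) ∧
      (∀ n, Function.Surjective (f n)) ∧
      (∀ n, Simplicial (Y (n + 1)).gl (Y n).gl (f n)) ∧
      (∀ n, ∀ y, y ∉ (Y n).gl.V → ((f n) ⁻¹' {y}).Subsingleton) ∧
      Nonempty (X ≃ₜ InvLim Y f) ∧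
      (ConnectedSpace X ↔ ∀ n, ConnectedSpace (Y n).carrier) ∧
      ((∀ S : G.Separation, G.EvenCut S.A S.B) ↔
        ∀ n, ∀ v ∈ (Y n).gl.V, (Y n).gl.EvenCut {v} ((Y n).gl.V \ {v})) ∧
      (ConnectedSpace X → ∀ n, ∀ y : (Y n).carrier, IsPreconnected ((f n) ⁻¹' {y})) :=
  ⟨fun n => (S n).TG hψ, fun n => bond (S := S) hψ n, fun n => (S n).TG_finite hψ,
    fun n => T.bond_surj hψ n, fun n => T.bond_simplicial hψ n, fun n => T.bond_fib hψ n,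
    T.limit_homeo hψ, T.connected_iff hψ, T.even_iff hψ G hr,
    fun h n y => T.bond_mono hψ (hc h) n y⟩

end Tower

section Build

variable {E : Type} [TopologicalSpace E] [DiscreteTopology E] {ψ : E × I01 → X}
  [CompactSpace X] [TopologicalSpace.MetrizableSpace X]

/-- complement of finitely many edges -/
def KK (ψ : E × I01 → X) (F : Set E) : Set X := {x | ∀ i ∈ F, x ∉ edg ψ i}

theorem KK_closed (hψ : IsOpenEmbedding ψ) (F : Set E) : IsClosed (KK ψ F) := by
  have : KK ψ F = (⋃ i ∈ F, edg ψ i)ᶜ := by ext; simp [KK]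
  rw [this]
  exact (isOpen_biUnion fun i _ => edg_isOpen hψ i).isClosed_compl

theorem V_subset_KK (F : Set E) : (Set.range ψ)ᶜ ⊆ KK ψ F := by
  rintro x hx i _ ⟨t, ht⟩
  exact hx ⟨_, ht⟩

theorem V_nonempty (hψ : IsOpenEmbedding ψ)
    (hT : TotallyDisconnectedSpace ((Set.range ψ)ᶜ : Set X)) (x : X) :
    ∃ y, y ∉ Set.range ψ := by
  by_cases hx : x ∈ Set.range ψ
  · obtain ⟨⟨i, t⟩, rfl⟩ := hx
    obtain ⟨s, hs, _⟩ := exists_end hψ hT i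
    exact ⟨s, hs⟩
  · exact ⟨x, hx⟩

theorem mkStage (hψ : IsOpenEmbedding ψ)
    (hT : TotallyDisconnectedSpace ((Set.range ψ)ᶜ : Set X)) (F : Set E) (hF : F.Finite)
    {κ : Type*} (p0 : X → κ) (hfin : (p0 '' KK ψ F).Finite)
    (hcl : ∀ c, IsClosed {x | x ∈ KK ψ F ∧ p0 x = c}) :
    ∃ S : Stage ψ, S.F = F ∧ ∀ x ∈ KK ψ F, ∀ y ∈ KK ψ F, S.p x = S.p y ↔ p0 x = p0 y := by
  classical
  have := hfin.to_subtype
  obtain ⟨k, ⟨e⟩⟩ := Finite.exists_equiv_fin ↥(p0 '' KK ψ F)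
  let x0 : X → X := fun x => (V_nonempty hψ hT x).choose
  have hx0 : ∀ x, x0 x ∈ KK ψ F := fun x => V_subset_KK F (V_nonempty hψ hT x).choose_spec
  let p : X → Fin k := fun x =>
    if h : x ∈ KK ψ F then e ⟨p0 x, x, h, rfl⟩ else e ⟨p0 (x0 x), x0 x, hx0 x, rfl⟩
  have hp : ∀ x (h : x ∈ KK ψ F), p x = e ⟨p0 x, x, h, rfl⟩ := fun x h => dif_pos h
  have hiff : ∀ x ∈ KK ψ F, ∀ c, p x = c ↔ p0 x = (e.symm c).1 := by
    intro x hx c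
    rw [hp x hx, ← Equiv.eq_symm_apply, Subtype.ext_iff]
  refine ⟨{ F := F, finF := hF, ι := Fin k, finι := inferInstance, p := p,
            closed := ?_, surj := ?_ }, rfl, ?_⟩
  · intro a
    convert hcl (e.symm a).1 using 1
    ext x
    constructor
    · rintro ⟨h1, h2⟩; exact ⟨h1, (hiff x h1 a).1 h2⟩
    · rintro ⟨h1, h2⟩; exact ⟨h1, (hiff x h1 a).2 h2⟩
  · intro a
    obtain ⟨x, hx, h⟩ := (e.symm a).2
    exact ⟨x, hx, (hiff x hx a).2 h⟩
  · intro x hx y hy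
    change p x = p y ↔ _
    rw [hiff x hx, hp y hy, Equiv.symm_apply_apply]

theorem comp_finite (hψ : IsOpenEmbedding ψ)
    (hT : TotallyDisconnectedSpace ((Set.range ψ)ᶜ : Set X)) (hX : ConnectedSpace X)
    (F : Set E) (hF : F.Finite) :
    ((fun x => connectedComponentIn (KK ψ F) x) '' KK ψ F).Finite := by
  rcases Set.eq_empty_or_nonempty F with rfl | ⟨i0, hi0⟩
  · have hu : KK ψ (∅ : Set E) = Set.univ := by ext; simp [KK]
    rw [hu]
    refine (Set.finite_singleton (Set.univ : Set X)).subset ?_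
    rintro _ ⟨x, _, rfl⟩
    simp [connectedComponentIn_univ, PreconnectedSpace.connectedComponent_eq_univ]
  choose s t hs ht hst using exists_ends hψ hT
  let P : Set X := s '' F ∪ t '' F
  have hP : P.Finite := (hF.image _).union (hF.image _)
  refine (hP.image (fun x => connectedComponentIn (KK ψ F) x)).subset ?_
  rintro _ ⟨x, hx, rfl⟩
  by_contra hcon
  have hno : ∀ z ∈ P, z ∉ connectedComponentIn (KK ψ F) x := by
    intro z hz hzc
    exact hcon ⟨z, hz, (connectedComponentIn_eq hzc).symm⟩
  have hKc := KK_closed hψ F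
  have : CompactSpace (KK ψ F) := isCompact_iff_compactSpace.1 hKc.isCompact
  have hclop : ∀ z : KK ψ F, z.1 ∈ P → ∃ Z : Set (KK ψ F), IsClopen Z ∧ ⟨x, hx⟩ ∈ Z ∧ z ∉ Z := by
    intro z hz
    have h := hno z hz
    rw [connectedComponentIn_eq_image hx] at h
    have h2 : z ∉ connectedComponent (⟨x, hx⟩ : KK ψ F) := fun h' => h ⟨z, h', rfl⟩
    rw [connectedComponent_eq_iInter_isClopen, Set.mem_iInter] at h2
    push Not at h2
    obtain ⟨⟨Z, hZ, hxZ⟩, hzZ⟩ := h2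
    exact ⟨Z, hZ, hxZ, hzZ⟩
  choose! Zf hZ1 hZ2 hZ3 using hclop
  let Q : Set (KK ψ F) := {z | z.1 ∈ P}
  have hQ : Q.Finite := hP.preimage Subtype.val_injective.injOn
  let Z : Set (KK ψ F) := ⋂ z ∈ Q, Zf z
  have hZ : IsClopen Z := hQ.isClopen_biInter fun z hz => hZ1 z hz
  have hxZ : ⟨x, hx⟩ ∈ Z := Set.mem_iInter₂.2 fun z hz => hZ2 z hz
  have hZP : ∀ z ∈ Z, z.1 ∉ P := fun z hz hzP => hZ3 z hzP (Set.mem_iInter₂.1 hz z hzP)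
  have hce := hKc.isClosedEmbedding_subtypeVal
  have hcompl : (Subtype.val '' Z)ᶜ = Subtype.val '' Zᶜ ∪ ⋃ i ∈ F, closure (edg ψ i) := by
    ext y
    constructor
    · intro hy
      by_cases hyK : y ∈ KK ψ F
      · left; exact ⟨⟨y, hyK⟩, fun h => hy ⟨_, h, rfl⟩, rfl⟩
      · right
        simp only [KK, Set.mem_ofPred_eq, not_forall, not_not] at hyK
        obtain ⟨i, hi, hyi⟩ := hyK
        exact Set.mem_biUnion hi (subset_closure hyi)
    · rintro (⟨z, hz, rfl⟩ | hy)
      · rintro ⟨w, hw, hwz⟩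
        rw [Subtype.ext hwz] at hw
        exact hz hw
      · rintro ⟨w, hw, rfl⟩
        rw [Set.mem_iUnion₂] at hy
        obtain ⟨i, hi, hy⟩ := hy
        by_cases hr : w.1 ∈ Set.range ψ
        · exact w.2 i hi (closure_edg hψ i hy hr)
        · apply hZP w hw
          rcases (hst i _ hr).1 hy with h | h
          · left; exact ⟨i, hi, h.symm⟩
          · right; exact ⟨i, hi, h.symm⟩
  have hfinal : IsClopen (Subtype.val '' Z) := by
    refine ⟨hce.isClosedMap _ hZ.isClosed, ?_⟩
    rw [← isClosed_compl_iff, hcompl]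
    exact (hce.isClosedMap _ hZ.compl.isClosed).union
      (hF.isClosed_biUnion fun i _ => isClosed_closure)
  have huniv := hfinal.eq_univ ⟨x, ⟨x, hx⟩, hxZ, rfl⟩
  obtain ⟨y, hy⟩ := edg_nonempty (ψ := ψ) i0
  have : y ∈ Subtype.val '' Z := huniv ▸ Set.mem_univ y
  obtain ⟨w, _, rfl⟩ := this
  exact w.2 i0 hi0 hy

theorem conn_stage (hψ : IsOpenEmbedding ψ)
    (hT : TotallyDisconnectedSpace ((Set.range ψ)ᶜ : Set X)) (hX : ConnectedSpace X)
    (F : Set E) (hF : F.Finite) :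
    ∃ S : Stage ψ, S.F = F ∧ ∀ a, IsPreconnected {x | x ∈ S.K ∧ S.p x = a} := by
  have hfib : ∀ x ∈ KK ψ F, {y | y ∈ KK ψ F ∧ connectedComponentIn (KK ψ F) y =
      connectedComponentIn (KK ψ F) x} = connectedComponentIn (KK ψ F) x := by
    intro x hx
    ext y
    constructor
    · rintro ⟨hy, h⟩
      rw [← h]; exact mem_connectedComponentIn hy
    · intro h
      exact ⟨connectedComponentIn_subset _ _ h, (connectedComponentIn_eq h).symm⟩
  obtain ⟨S, hSF, hS⟩ := mkStage hψ hT F hF (fun x => connectedComponentIn (KK ψ F) x)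
    (comp_finite hψ hT hX F hF) (by
      intro c
      rcases Set.eq_empty_or_nonempty
        {x | x ∈ KK ψ F ∧ connectedComponentIn (KK ψ F) x = c} with h | ⟨x, hx, rfl⟩
      · rw [h]; exact isClosed_empty
      · rw [hfib x hx]
        rw [connectedComponentIn_eq_image hx]
        exact (KK_closed hψ F).isClosedEmbedding_subtypeVal.isClosedMap _
          isClosed_connectedComponent)
  refine ⟨S, hSF, fun a => ?_⟩
  have hK : S.K = KK ψ F := by unfold Stage.K KK; rw [hSF]
  obtain ⟨x, hx, rfl⟩ := S.surj a
  have hx' : x ∈ KK ψ F := hK ▸ hx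
  have : {y | y ∈ S.K ∧ S.p y = S.p x} = connectedComponentIn (KK ψ F) x := by
    rw [← hfib x hx', hK]
    ext y
    constructor
    · rintro ⟨h1, h2⟩; exact ⟨h1, (hS y h1 x hx').1 h2⟩
    · rintro ⟨h1, h2⟩; exact ⟨h1, (hS y h1 x hx').2 h2⟩
  rw [this]
  exact isPreconnected_connectedComponentIn

theorem exists_exh (hψ : IsOpenEmbedding ψ) : ∃ F : ℕ → Set E, (∀ n, (F n).Finite) ∧
    Monotone F ∧ ∀ i, ∃ n, i ∈ F n := by
  have := countable_E hψ
  obtain ⟨g, hg⟩ := exists_injective_nat E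
  refine ⟨fun n => {i | g i < n}, fun n => (Set.finite_lt_nat n).preimage hg.injOn,
    fun m n h i (hi : g i < m) => lt_of_lt_of_le hi h, fun i => ⟨g i + 1, Nat.lt_succ_self _⟩⟩

theorem sep_pts (hψ : IsOpenEmbedding ψ)
    (hT : TotallyDisconnectedSpace ((Set.range ψ)ᶜ : Set X)) {x y : X}
    (hx : x ∉ Set.range ψ) (hy : y ∉ Set.range ψ) (hxy : x ≠ y) :
    ∃ U W, IsOpen U ∧ IsOpen W ∧ Disjoint U W ∧ x ∈ U ∧ y ∈ W ∧
      ∃ F : Set E, F.Finite ∧ (U ∪ W)ᶜ ⊆ ⋃ i ∈ F, edg ψ i := by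
  obtain ⟨A, B, hA, hB, hd, hu, hxA, hAy⟩ := exists_clopen hψ hT hx
    (isOpen_compl_singleton (x := y)) hxy
  obtain ⟨U, W, hU, hW, hUW, hAU, hBW, F, hF, hFc⟩ := sep_open hψ hA hB hd hu
  refine ⟨U, W, hU, hW, hUW, hAU hxA, hBW ?_, F, hF, hFc⟩
  have : y ∈ A ∪ B := hu ▸ hy
  rcases this with h | h
  · exact absurd rfl (hAy h)
  · exact h

theorem KK_cover {F F' : Set E} (h : F' ⊆ F) {U W : Set X}
    (hc : (U ∪ W)ᶜ ⊆ ⋃ i ∈ F', edg ψ i) : KK ψ F ⊆ U ∪ W := by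
  intro x hx
  by_contra hxn
  have := hc hxn
  rw [Set.mem_iUnion₂] at this
  obtain ⟨i, hi, hxi⟩ := this
  exact hx i (h hi) hxi

theorem tower_conn (hψ : IsOpenEmbedding ψ)
    (hT : TotallyDisconnectedSpace ((Set.range ψ)ᶜ : Set X)) (hX : ConnectedSpace X) :
    ∃ S : ℕ → Stage ψ, Tower S ∧ ∀ n a, IsPreconnected {x | x ∈ (S n).K ∧ (S n).p x = a} := by
  obtain ⟨F, hFf, hFm, hFe⟩ := exists_exh hψ
  choose S hSF hSp using fun n => conn_stage hψ hT hX (F n) (hFf n)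
  refine ⟨S, ⟨?_, ?_, ?_, ?_⟩, hSp⟩
  · intro n
    rw [hSF, hSF]; exact hFm (Nat.le_succ n)
  · intro n x y hx hy h
    refine (S n).p_const (hSp (n+1) ((S (n+1)).p y)) ?_ ⟨hx, h⟩ ⟨hy, rfl⟩
    rintro z ⟨hz, _⟩ i hi
    apply hz i
    rw [hSF] at hi ⊢
    exact hFm (Nat.le_succ n) hi
  · intro i
    obtain ⟨n, hn⟩ := hFe i
    exact ⟨n, by rw [hSF]; exact hn⟩
  · intro x y hx hy hxy
    obtain ⟨U, W, hU, hW, hUW, hxU, hyW, F', hF', hc⟩ := sep_pts hψ hT hx hy hxy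
    obtain ⟨n, hn⟩ : ∃ n, F' ⊆ F n := by
      choose g hg using hFe
      exact ⟨hF'.toFinset.sup g, fun i hi =>
        hFm (Finset.le_sup (hF'.mem_toFinset.2 hi)) (hg i)⟩
    refine ⟨n, fun heq => ?_⟩
    have hxm : x ∈ {z | z ∈ (S n).K ∧ (S n).p z = (S n).p x} := ⟨(S n).V_subset_K hx, rfl⟩
    have hsub := (hSp n ((S n).p x)).subset_left_of_subset_union hU hW hUW
      (by
        rintro z ⟨hz, _⟩
        apply KK_cover hn hc
        intro i hi; exact hz i (by rw [hSF]; exact hi))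
      ⟨x, hxm, hxU⟩
    exact Set.disjoint_left.1 hUW (hsub ⟨(S n).V_subset_K hy, heq.symm⟩) hyW

theorem exists_seq (hψ : IsOpenEmbedding ψ)
    (hT : TotallyDisconnectedSpace ((Set.range ψ)ᶜ : Set X)) :
    ∃ (U W : ℕ → Set X) (F : ℕ → Set E), (∀ k, IsOpen (U k) ∧ IsOpen (W k) ∧
      Disjoint (U k) (W k) ∧ (F k).Finite ∧ (U k ∪ W k)ᶜ ⊆ ⋃ i ∈ F k, edg ψ i) ∧
      ∀ x y, x ∉ Set.range ψ → y ∉ Set.range ψ → x ≠ y → ∃ k, x ∈ U k ∧ y ∈ W k := by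
  let D : Set (X × X) := {z | z.1 ∉ Set.range ψ ∧ z.2 ∉ Set.range ψ ∧ z.1 ≠ z.2}
  have hD : ∀ z : X × X, z ∈ D → ∃ U W, IsOpen U ∧ IsOpen W ∧ Disjoint U W ∧ z.1 ∈ U ∧ z.2 ∈ W ∧
      ∃ F : Set E, F.Finite ∧ (U ∪ W)ᶜ ⊆ ⋃ i ∈ F, edg ψ i :=
    fun z hz => sep_pts hψ hT hz.1 hz.2.1 hz.2.2
  choose! U W hU hW hUW hxU hyW F hF hc using hD
  have : SecondCountableTopology X := inferInstance
  obtain ⟨t, htD, htc, hcov⟩ := TopologicalSpace.countable_cover_nhdsWithin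
    (f := fun z => U z ×ˢ W z) (s := D) (fun z hz => mem_nhdsWithin_of_mem_nhds
      (((hU z hz).prod (hW z hz)).mem_nhds ⟨hxU z hz, hyW z hz⟩))
  rcases Set.eq_empty_or_nonempty t with rfl | hne
  · refine ⟨fun _ => Set.univ, fun _ => ∅, fun _ => ∅, fun k => by simp, ?_⟩
    intro x y hx hy hxy
    have : (x, y) ∈ D := ⟨hx, hy, hxy⟩
    simpa using hcov this
  · obtain ⟨e, rfl⟩ := htc.exists_eq_range hne
    have he : ∀ k, e k ∈ D := fun k => htD ⟨k, rfl⟩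
    refine ⟨fun k => U (e k), fun k => W (e k), fun k => F (e k),
      fun k => ⟨hU _ (he k), hW _ (he k), hUW _ (he k), hF _ (he k), hc _ (he k)⟩, ?_⟩
    intro x y hx hy hxy
    have : (x, y) ∈ D := ⟨hx, hy, hxy⟩
    have := hcov this
    rw [Set.mem_iUnion₂] at this
    obtain ⟨_, ⟨k, rfl⟩, h⟩ := this
    exact ⟨k, h.1, h.2⟩

theorem tower_gen (hψ : IsOpenEmbedding ψ)
    (hT : TotallyDisconnectedSpace ((Set.range ψ)ᶜ : Set X)) :
    ∃ S : ℕ → Stage ψ, Tower S := by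
  classical
  obtain ⟨F0, hFf, hFm, hFe⟩ := exists_exh hψ
  obtain ⟨U, W, F1, h1, hsep⟩ := exists_seq hψ hT
  let F : ℕ → Set E := fun n => F0 n ∪ ⋃ k ∈ Set.Iio n, F1 k
  have hF : ∀ n, (F n).Finite := fun n =>
    (hFf n).union ((Set.finite_Iio n).biUnion fun k _ => (h1 k).2.2.2.1)
  have hmono : Monotone F := fun m n h => Set.union_subset_union (hFm h)
    (Set.biUnion_subset_biUnion_left (Set.Iio_subset_Iio h))
  have hcov : ∀ n k, k < n → KK ψ (F n) ⊆ U k ∪ W k := by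
    intro n k hk
    refine KK_cover (F' := F1 k) ?_ (h1 k).2.2.2.2
    exact (Set.subset_biUnion_of_mem (u := F1) (show k ∈ Set.Iio n from hk)).trans
      Set.subset_union_right
  let p0 : ∀ n, X → (Fin n → Prop) := fun n x k => x ∈ U k
  have hst : ∀ n, ∃ S : Stage ψ, S.F = F n ∧
      ∀ x ∈ KK ψ (F n), ∀ y ∈ KK ψ (F n), S.p x = S.p y ↔ p0 n x = p0 n y := by
    intro n
    refine mkStage hψ hT (F n) (hF n) (p0 n) (Set.toFinite _) ?_
    intro c
    have : {x | x ∈ KK ψ (F n) ∧ p0 n x = c} =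
        KK ψ (F n) ∩ ⋂ k : Fin n, (if c k then (W k)ᶜ else (U k)ᶜ) := by
      ext x
      simp only [Set.mem_ofPred_eq, Set.mem_inter_iff, Set.mem_iInter]
      refine and_congr_right fun hx => ?_
      rw [funext_iff]
      refine forall_congr' fun k => ?_
      have hor := hcov n k k.2 hx
      have hdis : x ∈ U k → x ∉ W k := fun h => Set.disjoint_left.1 (h1 k).2.2.1 h
      by_cases hck : c k
      · simp only [p0, hck, if_true, eq_iff_iff, iff_true, Set.mem_compl_iff]
        exact ⟨fun h => hdis h, fun h => hor.resolve_right h⟩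
      · simp only [p0, hck, if_false, eq_iff_iff, iff_false, Set.mem_compl_iff]
    rw [this]
    refine (KK_closed hψ _).inter (isClosed_iInter fun k => ?_)
    split_ifs
    · exact (h1 k).2.1.isClosed_compl
    · exact (h1 k).1.isClosed_compl
  choose S hSF hSp using hst
  have hK : ∀ n, (S n).K = KK ψ (F n) := by intro n; unfold Stage.K KK; rw [hSF]
  have hKm : ∀ n, KK ψ (F (n+1)) ⊆ KK ψ (F n) :=
    fun n x hx i hi => hx i (hmono (Nat.le_succ n) hi)
  refine ⟨S, ?_, ?_, ?_, ?_⟩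
  · intro n
    rw [hSF, hSF]; exact hmono (Nat.le_succ n)
  · intro n x y hx hy h
    rw [hK] at hx hy
    rw [hSp n x (hKm n hx) y (hKm n hy)]
    rw [hSp (n+1) x hx y hy] at h
    funext k
    exact congrFun h k.castSucc
  · intro i
    obtain ⟨n, hn⟩ := hFe i
    exact ⟨n, by rw [hSF]; exact Or.inl hn⟩
  · intro x y hx hy hxy
    obtain ⟨k, hxU, hyW⟩ := hsep x y hx hy hxy
    refine ⟨k + 1, fun h => ?_⟩
    rw [hSp (k+1) x (V_subset_KK _ hx) y (V_subset_KK _ hy)] at h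
    have := congrFun h (Fin.last k)
    simp only [p0, Fin.val_last, hxU, eq_iff_iff, true_iff] at this
    exact Set.disjoint_left.1 (h1 k).2.2.1 this hyW

end Build

/-- Every compact graph-like space is homeomorphic to the inverse limit
of a sequence of topological finite multi-graphs with surjective simplicial bonding maps
whose fibres are singletons except over vertices, such that (1) `X` is connected iff all
the finite graphs are, and (2) all cuts of `X` are even iff all vertices of all the
finite graphs are even.  Moreover, if `X` is connected the bonding maps can additionally
be chosen monotone. -/
theorem inverse_limit_representation
    [CompactSpace X] [TopologicalSpace.MetrizableSpace X] (G : GraphLike X) :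
    ∃ (Y : ℕ → TopGraphLike) (f : ∀ n, (Y (n + 1)).carrier → (Y n).carrier),
      (∀ n, (Y n).IsFiniteMultiGraph) ∧
      (∀ n, Function.Surjective (f n)) ∧
      (∀ n, Simplicial (Y (n + 1)).gl (Y n).gl (f n)) ∧
      (∀ n, ∀ y, y ∉ (Y n).gl.V → ((f n) ⁻¹' {y}).Subsingleton) ∧
      Nonempty (X ≃ₜ InvLim Y f) ∧
      (ConnectedSpace X ↔ ∀ n, ConnectedSpace (Y n).carrier) ∧
      ((∀ S : G.Separation, G.EvenCut S.A S.B) ↔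
        ∀ n, ∀ v ∈ (Y n).gl.V, (Y n).gl.EvenCut {v} ((Y n).gl.V \ {v})) ∧
      (ConnectedSpace X → ∀ n, ∀ y : (Y n).carrier, IsPreconnected ((f n) ⁻¹' {y})) := by
  letI : TopologicalSpace G.E := ⊥
  haveI : DiscreteTopology G.E := ⟨rfl⟩
  obtain ⟨φ⟩ := G.homeo
  let ψ : G.E × I01 → X := fun z => (φ.symm z).1
  have hψ : IsOpenEmbedding ψ :=
    G.closedV.isOpen_compl.isOpenEmbedding_subtypeVal.comp φ.symm.isOpenEmbedding
  have hr : Set.range ψ = G.Vᶜ := by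
    have : ψ = Subtype.val ∘ φ.symm := rfl
    rw [this, φ.symm.surjective.range_comp, Subtype.range_coe]
  have hV : G.V = (Set.range ψ)ᶜ := by rw [hr, compl_compl]
  have hT : TotallyDisconnectedSpace ((Set.range ψ)ᶜ : Set X) := hV ▸ G.zeroDimV
  by_cases hX : ConnectedSpace X
  · obtain ⟨S, T, hS⟩ := tower_conn hψ hT hX
    exact T.main hψ G hr fun _ => hS
  · obtain ⟨S, T⟩ := tower_gen hψ hT
    exact T.main hψ G hr fun h => absurd h hX
end

section
/- Let (X_n)_{n∈ℕ} be a sequence of connected topological finite multi-graphs and let f_n : X_{n+1} → X_n be surjective continuous monotone bonding maps satisfying f_n(V(X_{n+1})) ⊆ V(X_n), where V(X_n) denotes the vertex set of X_n. Then the inverse limit X = lim← (X_n, f_n) is a graph-like continuum. -/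
open Set Topology Filter Function

universe u

variable {X : Type u} [TopologicalSpace X]

/-- `Z` is a disjoint sum of open intervals. -/
def SumIoo (Z : Type) [TopologicalSpace Z] : Prop :=
  ∃ (E : Type) (_ : TopologicalSpace E) (_ : DiscreteTopology E),
    Nonempty (Z ≃ₜ E × ↥(Set.Ioo (0 : ℝ) 1))

theorem SumIoo.of_cover {Z : Type} [TopologicalSpace Z] {ι : Type} (O : ι → Set Z)
    (hO : ∀ i, IsOpen (O i)) (hd : ∀ i j z, z ∈ O i → z ∈ O j → i = j)
    (hc : ∀ z, ∃ i, z ∈ O i) (hP : ∀ i, SumIoo (O i)) : SumIoo Z := by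
  choose E t d hh using hP
  have hh' := fun i => (hh i).some
  have hs : IsHomeomorph (Sigma.map id (fun i => hh' i) :
      (Σ i, O i) → Σ i, E i × ↥(Set.Ioo (0 : ℝ) 1)) :=
    IsHomeomorph.sigmaMap bijective_id (fun i => (hh' i).isHomeomorph)
  have hb : IsHomeomorph (fun p : (Σ i, O i) => (p.2 : Z)) := by
    refine ⟨?_, ?_, ?_, ?_⟩
    · exact continuous_sigma (fun i => continuous_subtype_val)
    · exact isOpenMap_sigma.2 (fun i => (hO i).isOpenMap_subtype_val)
    · rintro ⟨i, x, hx⟩ ⟨j, y, hy⟩ h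
      simp only at h
      subst h
      obtain rfl := hd i j x hx hy
      rfl
    · intro z
      obtain ⟨i, hi⟩ := hc z
      exact ⟨⟨i, z, hi⟩, rfl⟩
  exact ⟨Σ i, E i, inferInstance, inferInstance,
    ⟨(hb.homeomorph.symm.trans hs.homeomorph).trans Homeomorph.sigmaProdDistrib.symm⟩⟩

theorem SumIoo.of_homeo {Z Z' : Type} [TopologicalSpace Z] [TopologicalSpace Z']
    (h : Z ≃ₜ Z') (hP : SumIoo Z') : SumIoo Z := by
  obtain ⟨E, a, b, ⟨c⟩⟩ := hP
  exact ⟨E, a, b, ⟨h.trans c⟩⟩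

theorem homeo_Ioo (S : Set ℝ) (ho : IsOpen S) (hp : IsPreconnected S) (hne : S.Nonempty)
    (hb : ∀ x ∈ S, |x| ≤ 2) : Nonempty (S ≃ₜ ↥(Set.Ioo (0 : ℝ) 1)) := by
  have hbb : BddBelow S := ⟨-2, fun x hx => (abs_le.1 (hb x hx)).1⟩
  have hba : BddAbove S := ⟨2, fun x hx => (abs_le.1 (hb x hx)).2⟩
  have hS : S = Ioo (sInf S) (sSup S) := by
    apply Subset.antisymm
    · intro x hx
      obtain ⟨a, b, ⟨h1, h2⟩, h3⟩ := mem_nhds_iff_exists_Ioo_subset.1 (ho.mem_nhds hx)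
      constructor
      · obtain ⟨y, hy1, hy2⟩ := exists_between h1
        exact lt_of_le_of_lt (csInf_le hbb (h3 ⟨hy1, hy2.trans h2⟩)) hy2
      · obtain ⟨y, hy1, hy2⟩ := exists_between h2
        exact lt_of_lt_of_le hy1 (le_csSup hba (h3 ⟨h1.trans hy1, hy2⟩))
    · exact IsConnected.Ioo_csInf_csSup_subset ⟨hne, hp⟩ hbb hba
  have hlt : sInf S < sSup S := by
    obtain ⟨x, hx⟩ := hne
    rw [hS] at hx
    exact hx.1.trans hx.2
  have := affineHomeomorph_image_Ioo (𝕜 := ℝ) (sSup S - sInf S) (sInf S) 0 1 (by linarith)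
  rw [hS]
  refine ⟨(((affineHomeomorph (sSup S - sInf S) (sInf S) (by linarith)).image (Ioo 0 1)).trans
    (Homeomorph.setCongr ?_)).symm⟩
  simpa using this

theorem SumIoo.of_embedding {Z : Type} [TopologicalSpace Z] (g : Z → ℝ) (hg : IsOpenEmbedding g)
    (hb : ∀ z, |g z| ≤ 2) : SumIoo Z := by
  have : LocallyConnectedSpace Z := hg.locallyConnectedSpace
  refine SumIoo.of_cover (ι := {s : Set Z // ∃ z, s = connectedComponent z}) (fun s => s.1)
    ?_ ?_ ?_ ?_
  · rintro ⟨s, z, rfl⟩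
    exact isOpen_connectedComponent
  · rintro ⟨s, z, rfl⟩ ⟨s', z', rfl⟩ w h h'
    ext1
    exact (connectedComponent_eq h).trans (connectedComponent_eq h').symm
  · intro z
    exact ⟨⟨_, z, rfl⟩, mem_connectedComponent⟩
  · rintro ⟨s, z, rfl⟩
    obtain ⟨h⟩ := homeo_Ioo (g '' connectedComponent z)
      (hg.isOpenMap _ isOpen_connectedComponent)
      (isPreconnected_connectedComponent.image _ hg.continuous.continuousOn)
      ⟨g z, z, mem_connectedComponent, rfl⟩ (by rintro _ ⟨w, -, rfl⟩; exact hb w)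
    refine ⟨Unit, inferInstance, inferInstance, ⟨?_⟩⟩
    exact ((hg.isEmbedding.homeomorphImage (connectedComponent z)).trans h).trans
      (Homeomorph.uniqueProd Unit _).symm

theorem ordConnected_diff_countable (A : Set ℝ) (hA : A.OrdConnected) :
    (closure A \ A).Countable := by
  have h : closure A \ A ⊆ {t | IsLUB A t} ∪ {t | IsGLB A t} := by
    rintro t ⟨ht, hn⟩
    by_cases h1 : t ∈ upperBounds A
    · left; exact isLUB_of_mem_closure h1 ht
    by_cases h2 : t ∈ lowerBounds A
    · right; exact isGLB_of_mem_closure h2 ht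
    exfalso
    simp only [upperBounds, lowerBounds, mem_ofPred_eq, not_forall, not_le] at h1 h2
    obtain ⟨a, ha, hat⟩ := h1
    obtain ⟨b, hb, hbt⟩ := h2
    exact hn (hA.out hb ha ⟨hbt.le, hat.le⟩)
  refine Countable.mono h (Countable.union ?_ ?_)
  · exact Set.Subsingleton.countable (fun a ha b hb => IsLUB.unique ha hb)
  · exact Set.Subsingleton.countable (fun a ha b hb => IsGLB.unique ha hb)

theorem assembly {X : Type} [TopologicalSpace X] (E : ℕ → Type) [∀ n, Finite (E n)]
    (U : ∀ n, E n → Set X) (ho : ∀ n c, IsOpen (U n c)) (hp : ∀ n c, IsPreconnected (U n c))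
    (hd : ∀ n c c' x, x ∈ U n c → x ∈ U n c' → c = c')
    (hmono : ∀ n, (⋃ c, U n c) ⊆ ⋃ c, U (n + 1) c)
    (hemb : ∀ n c, ∃ g : U n c → ℝ, IsOpenEmbedding g ∧ ∀ z, |g z| ≤ 2) :
    ∃ W : Set X, IsOpen W ∧ ((⋃ n, ⋃ c, U n c) \ W).Countable ∧ SumIoo W := by
  set Wn : ℕ → Set X := fun n => ⋃ c, U n c with hWn
  have hWo : ∀ n, IsOpen (Wn n) := fun n => isOpen_iUnion (ho n)
  have hWm : Monotone Wn := monotone_nat_of_le_succ hmono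
  let P : ℕ → Set X := fun n => ⋃ k, ⋃ (_ : k < n), Wn k
  have hP : ∀ n, P (n + 1) = Wn n := by
    intro n
    apply Subset.antisymm
    · refine iUnion₂_subset (fun k hk => hWm (by omega))
    · exact subset_iUnion₂_of_subset n (by omega) le_rfl
  have hP0 : P 0 = ∅ := by simp [P]
  let T : (Σ n, E n) → Set X := fun p => U p.1 p.2 \ closure (P p.1)
  have hTo : ∀ p, IsOpen (T p) := fun p => (ho _ _).sdiff isClosed_closure
  have hTU : ∀ p, T p ⊆ U p.1 p.2 := fun p => sdiff_subset
  have hkey : ∀ n c m c' x, x ∈ T ⟨n, c⟩ → x ∈ T ⟨m, c'⟩ → ¬ n < m := by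
    intro n c m c' x h h' hlt
    exact h'.2 (subset_closure (mem_iUnion₂.2 ⟨n, hlt, mem_iUnion.2 ⟨c, h.1⟩⟩))
  refine ⟨⋃ p, T p, isOpen_iUnion hTo, ?_, ?_⟩
  · have hsub : ((⋃ n, ⋃ c, U n c) \ ⋃ p, T p) ⊆
        ⋃ n, ⋃ c : E (n + 1), ⋃ c' : E n, (U (n + 1) c ∩ (closure (U n c') \ U n c')) := by
      rintro x ⟨hx, hxT⟩
      have hx' : ∃ n, x ∈ Wn n := mem_iUnion.1 hx
      classical
      have h1 := Nat.find_spec hx'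
      have h2 : ∀ k < Nat.find hx', x ∉ Wn k := fun k hk => Nat.find_min hx' hk
      obtain ⟨c, hc⟩ := mem_iUnion.1 h1
      generalize Nat.find hx' = N at *
      have h3 : x ∈ closure (P N) := by
        by_contra h
        exact hxT (mem_iUnion.2 ⟨⟨N, c⟩, hc, h⟩)
      cases N with
      | zero => simp [hP0] at h3
      | succ N =>
        rw [hP] at h3
        simp only [hWn] at h3
        rw [closure_iUnion_of_finite] at h3
        obtain ⟨c', hc'⟩ := mem_iUnion.1 h3
        refine mem_iUnion.2 ⟨N, mem_iUnion.2 ⟨c, mem_iUnion.2 ⟨c', hc, hc', ?_⟩⟩⟩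
        intro h
        exact h2 N (by omega) (mem_iUnion.2 ⟨c', h⟩)
    refine Countable.mono hsub ?_
    refine countable_iUnion (fun n => countable_iUnion (fun c => countable_iUnion (fun c' => ?_)))
    by_cases hint : (U (n + 1) c ∩ U n c').Nonempty
    · have hUU : U n c' ⊆ U (n + 1) c := by
        refine (hp n c').subset_left_of_subset_union (ho _ c)
          (v := ⋃ d, ⋃ (_ : d ≠ c), U (n + 1) d)
          (isOpen_iUnion fun d => isOpen_iUnion fun _ => ho _ d) ?_ ?_ ?_
        · rw [Set.disjoint_left]
          intro x hx hx'
          obtain ⟨d, hdc, hxd⟩ := mem_iUnion₂.1 hx'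
          exact hdc (hd _ _ _ x hxd hx)
        · intro x hx
          obtain ⟨d, hxd⟩ := mem_iUnion.1 (hmono n (mem_iUnion.2 ⟨c', hx⟩))
          by_cases hdc : d = c
          · left; rw [← hdc]; exact hxd
          · right; exact mem_iUnion₂.2 ⟨d, hdc, hxd⟩
        · rwa [inter_comm]
      obtain ⟨g, hg, -⟩ := hemb (n + 1) c
      let A : Set (U (n + 1) c) := Subtype.val ⁻¹' (U n c')
      have hAp : IsPreconnected A := by
        rw [← Topology.IsInducing.subtypeVal.isPreconnected_image]
        rw [Subtype.image_preimage_coe, inter_eq_right.2 hUU]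
        exact hp n c'
      have hoc : (g '' A).OrdConnected :=
        (hAp.image _ hg.continuous.continuousOn).ordConnected
      have hcount := ordConnected_diff_countable _ hoc
      have h2 : (g ⁻¹' (closure (g '' A) \ (g '' A))).Countable :=
        hcount.preimage_of_injOn hg.injective.injOn
      refine (h2.image Subtype.val).mono ?_
      rintro x ⟨hx1, hx2, hx3⟩
      refine ⟨⟨x, hx1⟩, ⟨?_, ?_⟩, rfl⟩
      · apply image_closure_subset_closure_image hg.continuous
        refine ⟨⟨x, hx1⟩, ?_, rfl⟩
        rw [closure_subtype, Subtype.image_preimage_coe, inter_eq_right.2 hUU]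
        exact hx2
      · rintro ⟨y, hy, hyx⟩
        have := hg.injective hyx
        subst this
        exact hx3 hy
    · convert countable_empty
      rw [eq_empty_iff_forall_notMem]
      rintro x ⟨hx1, hx2, -⟩
      exact hint (mem_closure_iff.1 hx2 _ (ho _ c) hx1)
  · refine SumIoo.of_cover (ι := Σ n, E n) (fun p => Subtype.val ⁻¹' (T p)) ?_ ?_ ?_ ?_
    · exact fun p => (hTo p).preimage continuous_subtype_val
    · rintro ⟨n, c⟩ ⟨m, c'⟩ ⟨x, hx⟩ h h'
      have e1 := hkey _ _ _ _ _ h h'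
      have e2 := hkey _ _ _ _ _ h' h
      obtain rfl : n = m := by omega
      obtain rfl := hd _ _ _ _ h.1 h'.1
      rfl
    · rintro ⟨x, hx⟩
      obtain ⟨p, hpx⟩ := mem_iUnion.1 hx
      exact ⟨p, hpx⟩
    · intro p
      obtain ⟨g, hg, hb⟩ := hemb p.1 p.2
      have hi : IsOpenEmbedding (fun z : (Subtype.val ⁻¹' (T p) : Set ↥(⋃ p, T p)) =>
          (⟨z.1.1, hTU p z.2⟩ : U p.1 p.2)) := by
        have hval : IsOpenEmbedding (fun z : (Subtype.val ⁻¹' (T p) : Set ↥(⋃ p, T p)) =>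
            (z.1.1 : X)) :=
          (isOpen_iUnion hTo).isOpenEmbedding_subtypeVal.comp
            ((hTo p).preimage continuous_subtype_val).isOpenEmbedding_subtypeVal
        exact IsOpenEmbedding.of_comp _ (ho p.1 p.2).isOpenEmbedding_subtypeVal hval
      exact SumIoo.of_embedding (g ∘ _) (hg.comp hi) (fun z => hb _)

theorem mono_or_anti {U : Type} [TopologicalSpace U] (a b : U → ℝ) (hbc : Continuous b)
    (href : ∀ x y, b x = b y → a x = a y)
    (ha : ∀ S : Set ℝ, S.OrdConnected → IsPreconnected (a ⁻¹' S)) :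
    (∀ x y, b x ≤ b y → a x ≤ a y) ∨ (∀ x y, b x ≤ b y → a y ≤ a x) := by
  have hsurj : ∀ t : range b, ∃ x, b x = t := fun t => t.2
  choose s hs using hsurj
  have hsa : ∀ x, a (s ⟨b x, x, rfl⟩) = a x := fun x => href _ _ (hs _)
  have key : ∀ S : Set ℝ, S.OrdConnected → ∀ p q r : range b, r ∈ uIcc p q →
      a (s p) ∈ S → a (s q) ∈ S → a (s r) ∈ S := by
    intro S hS p q r hr hp hq
    have hoc : (b '' (a ⁻¹' S)).OrdConnected :=
      ((ha S hS).image _ hbc.continuousOn).ordConnected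
    have h1 : (p : ℝ) ∈ b '' (a ⁻¹' S) := ⟨s p, hp, hs p⟩
    have h2 : (q : ℝ) ∈ b '' (a ⁻¹' S) := ⟨s q, hq, hs q⟩
    have h3 : (r : ℝ) ∈ b '' (a ⁻¹' S) := by
      apply hoc.uIcc_subset h1 h2
      rw [mem_uIcc] at hr ⊢
      exact hr
    obtain ⟨x, hx, hxr⟩ := h3
    have : a (s r) = a x := href _ _ ((hs r).trans hxr.symm)
    rw [this]
    exact hx
  have hmain : Monotone (a ∘ s) ∨ Antitone (a ∘ s) := by
    rw [monotone_or_antitone_iff_uIcc]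
    intro p q r hr
    exact key _ ordConnected_uIcc p q r hr left_mem_uIcc right_mem_uIcc
  rcases hmain with h | h
  · left
    intro x y hxy
    have := h (show (⟨b x, x, rfl⟩ : range b) ≤ ⟨b y, y, rfl⟩ from hxy)
    simpa [hsa] using this
  · right
    intro x y hxy
    have := h (show (⟨b x, x, rfl⟩ : range b) ≤ ⟨b y, y, rfl⟩ from hxy)
    simpa [hsa] using this

theorem interval_embedding {U : Type} [TopologicalSpace U] [PreconnectedSpace U]
    (ψ : ℕ → U → ℝ) (hc : ∀ k, Continuous (ψ k)) (hb : ∀ k x, |ψ k x| ≤ 1)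
    (href : ∀ k x y, ψ (k + 1) x = ψ (k + 1) y → ψ k x = ψ k y)
    (hpre : ∀ k, ∀ S : Set ℝ, S.OrdConnected → IsPreconnected (ψ k ⁻¹' S))
    (hsep : ∀ x y, (∀ k, ψ k x = ψ k y) → x = y)
    (hlo : ∀ x, ∃ y, ψ 0 y < ψ 0 x) (hhi : ∀ x, ∃ y, ψ 0 x < ψ 0 y)
    (hcpt : ∀ p q, IsCompact (ψ 0 ⁻¹' (Icc (ψ 0 p) (ψ 0 q)))) :
    ∃ g : U → ℝ, IsOpenEmbedding g ∧ ∀ z, |g z| ≤ 2 := by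
  have hδ : ∀ k, ∃ δ : ℝ, (δ = 1 ∨ δ = -1) ∧
      ∀ x y, ψ (k + 1) x ≤ ψ (k + 1) y → δ * ψ k x ≤ δ * ψ k y := by
    intro k
    rcases mono_or_anti (ψ k) (ψ (k + 1)) (hc _) (href k) (hpre k) with h | h
    · exact ⟨1, Or.inl rfl, fun x y hxy => by simpa using h x y hxy⟩
    · exact ⟨-1, Or.inr rfl, fun x y hxy => by simpa using h x y hxy⟩
  choose δ hδ1 hδ2 using hδ
  let ε : ℕ → ℝ := fun k => ∏ i ∈ Finset.range k, δ i
  have hε0 : ε 0 = 1 := by simp [ε]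
  have hεs : ∀ k, ε (k + 1) = ε k * δ k := fun k => Finset.prod_range_succ _ _
  have hε : ∀ k, ε k = 1 ∨ ε k = -1 := by
    intro k
    induction k with
    | zero => left; exact hε0
    | succ k ih =>
      rw [hεs]
      rcases ih with h | h <;> rcases hδ1 k with h' | h' <;> simp [h, h']
  let θ : ℕ → U → ℝ := fun k x => ε k * ψ k x
  have hθ0 : ∀ x, θ 0 x = ψ 0 x := fun x => by simp [θ, hε0]
  have hθc : ∀ k, Continuous (θ k) := fun k => continuous_const.mul (hc k)
  have hθb : ∀ k x, |θ k x| ≤ 1 := by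
    intro k x
    rcases hε k with h | h <;> simpa [θ, h] using hb k x
  have hθm : ∀ k x y, θ (k + 1) x ≤ θ (k + 1) y → θ k x ≤ θ k y := by
    intro k x y h
    simp only [θ] at h ⊢
    have h1 := hδ2 k x y
    have h2 := hδ2 k y x
    rw [hεs] at h
    rcases hε k with e | e <;> rcases hδ1 k with e' | e' <;> simp only [e, e'] at h h1 h2 ⊢ <;>
      first
      | (have := h1 (by linarith); linarith)
      | (have := h2 (by linarith); linarith)
  have hθm' : ∀ k l, k ≤ l → ∀ x y, θ l x ≤ θ l y → θ k x ≤ θ k y := by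
    intro k l hkl x y
    induction l, hkl using Nat.le_induction with
    | base => exact id
    | succ l _ ih => exact fun h => ih (hθm l x y h)
  have hθall : ∀ k x y, θ k x < θ k y → ∀ l, θ l x ≤ θ l y := by
    intro k x y h l
    rcases le_total l k with hl | hl
    · exact hθm' l k hl x y h.le
    · by_contra hcon
      exact absurd (hθm' k l hl y x (not_le.1 hcon).le) (not_le.2 h)
  let w : ℕ → ℝ := fun k => (1 / 2) ^ k
  have hw : Summable w := summable_geometric_two
  have hwp : ∀ k, 0 < w k := fun k => by positivity
  have hbd : ∀ k x, ‖w k * θ k x‖ ≤ w k := by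
    intro k x
    rw [Real.norm_eq_abs, abs_mul, abs_of_pos (hwp k)]
    exact mul_le_of_le_one_right (hwp k).le (hθb k x)
  let g : U → ℝ := fun x => ∑' k, w k * θ k x
  have hsum : ∀ x, Summable (fun k => w k * θ k x) := fun x =>
    Summable.of_norm_bounded hw (fun k => hbd k x)
  have hgc : Continuous g := continuous_tsum (fun k => continuous_const.mul (hθc k)) hw hbd
  have hgb : ∀ x, |g x| ≤ 2 := by
    intro x
    have := tsum_of_norm_bounded (hasSum_geometric_two) (fun k => hbd k x)
    simpa using this
  have hglt : ∀ k x y, θ k x < θ k y → g x < g y := by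
    intro k x y h
    refine Summable.tsum_lt_tsum (i := k) (fun l => ?_) ?_ (hsum x) (hsum y)
    · exact mul_le_mul_of_nonneg_left (hθall k x y h l) (hwp l).le
    · exact mul_lt_mul_of_pos_left h (hwp k)
  have hginj : Injective g := by
    intro x y hxy
    apply hsep
    intro k
    have h1 : θ k x = θ k y := by
      rcases lt_trichotomy (θ k x) (θ k y) with h | h | h
      · exact absurd hxy (hglt k x y h).ne
      · exact h
      · exact absurd hxy (hglt k y x h).ne'
    rcases hε k with e | e <;> simpa [θ, e] using h1
  have hg0 : ∀ x y, ψ 0 x < ψ 0 y → g x < g y := fun x y h => hglt 0 x y (by simpa [hθ0] using h)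
  have hg0' : ∀ x y, g x ≤ g y → ψ 0 x ≤ ψ 0 y := fun x y h => by
    by_contra hcon
    exact absurd (hg0 y x (not_le.1 hcon)) (not_lt.2 h)
  have hoc : (range g).OrdConnected := (isPreconnected_range hgc).ordConnected
  refine ⟨g, IsOpenEmbedding.of_continuous_injective_isOpenMap hgc hginj ?_, hgb⟩
  intro O hO
  rw [isOpen_iff_mem_nhds]
  rintro _ ⟨x, hx, rfl⟩
  obtain ⟨p, hp⟩ := hlo x
  obtain ⟨q, hq⟩ := hhi x
  have hK : IsCompact (g '' (ψ 0 ⁻¹' (Icc (ψ 0 p) (ψ 0 q)) \ O)) :=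
    ((hcpt p q).diff hO).image hgc
  have hx1 : g x ∉ g '' (ψ 0 ⁻¹' (Icc (ψ 0 p) (ψ 0 q)) \ O) := by
    rintro ⟨y, hy, hyx⟩
    rw [hginj hyx] at hy
    exact hy.2 hx
  filter_upwards [hK.isClosed.isOpen_compl.mem_nhds hx1,
    Ioo_mem_nhds (hg0 p x hp) (hg0 x q hq)] with t ht1 ht2
  obtain ⟨y, rfl⟩ := hoc.out ⟨p, rfl⟩ ⟨q, rfl⟩ ⟨ht2.1.le, ht2.2.le⟩
  by_contra hcon
  refine ht1 ⟨y, ⟨⟨hg0' _ _ ht2.1.le, hg0' _ _ ht2.2.le⟩, ?_⟩, rfl⟩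
  exact fun h => hcon ⟨y, h, rfl⟩

theorem preconn_preimage {X Z : Type} [TopologicalSpace X] [TopologicalSpace Z] (p : X → Z)
    (hcl : IsClosedMap p) (hs : Surjective p) (hf : ∀ z, IsPreconnected (p ⁻¹' {z}))
    {B : Set Z} (hB : IsPreconnected B) : IsPreconnected (p ⁻¹' B) := by
  rw [isPreconnected_closed_iff]
  rintro t t' ht ht' hsub ⟨x, hx, hxt⟩ ⟨y, hy, hyt⟩
  obtain ⟨b, hb, ⟨a, hat, hab⟩, ⟨a', hat', hab'⟩⟩ :=
    isPreconnected_closed_iff.1 hB (p '' t) (p '' t') (hcl _ ht) (hcl _ ht')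
      (by
        intro b hb
        obtain ⟨a, rfl⟩ := hs b
        rcases hsub hb with h | h
        · exact Or.inl ⟨a, h, rfl⟩
        · exact Or.inr ⟨a, h, rfl⟩)
      ⟨p x, hx, x, hxt, rfl⟩ ⟨p y, hy, y, hyt, rfl⟩
  obtain ⟨c, hc, hc'⟩ := isPreconnected_closed_iff.1 (hf b) t t' ht ht'
    (fun z hz => hsub (by rw [mem_preimage, mem_singleton_iff.1 hz]; exact hb))
    ⟨a, hab, hat⟩ ⟨a', hab', hat'⟩
  refine ⟨c, ?_, hc'⟩
  rw [mem_preimage, mem_singleton_iff.1 hc]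
  exact hb

abbrev SeqLim (A : ℕ → Type) (f : ∀ n, A (n + 1) → A n) : Type :=
  {x : ∀ n, A n // ∀ n, f n (x (n + 1)) = x n}

theorem seqLim_surj (n : ℕ) : ∀ (A : ℕ → Type) (f : ∀ n, A (n + 1) → A n)
    (_ : ∀ n, Surjective (f n)) (z : A n), ∃ x : SeqLim A f, x.1 n = z := by
  induction n with
  | zero =>
    intro A f hs z
    choose s hs' using hs
    exact ⟨⟨fun n => Nat.rec z (fun k y => s k y) n, fun n => hs' n _⟩, rfl⟩
  | succ n ih =>
    intro A f hs z
    obtain ⟨x, hx⟩ := ih (fun k => A (k + 1)) (fun k => f (k + 1)) (fun k => hs (k + 1)) z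
    refine ⟨⟨fun k => Nat.casesOn k (f 0 (x.1 0)) (fun k => x.1 k), ?_⟩, hx⟩
    intro k
    cases k with
    | zero => rfl
    | succ k => exact x.2 k

theorem seqLim_down {A : ℕ → Type} {f : ∀ n, A (n + 1) → A n} (x y : SeqLim A f) {n m : ℕ}
    (h : n ≤ m) (hxy : x.1 m = y.1 m) : x.1 n = y.1 n := by
  induction m, h using Nat.le_induction with
  | base => exact hxy
  | succ m _ ih => exact ih (by rw [← x.2, ← y.2, hxy])

section
variable {A : ℕ → Type} [∀ n, TopologicalSpace (A n)] [∀ n, CompactSpace (A n)]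
  [∀ n, T2Space (A n)] {f : ∀ n, A (n + 1) → A n}

theorem seqLim_compact (hc : ∀ n, Continuous (f n)) : CompactSpace (SeqLim A f) := by
  suffices h : IsClosed {x : ∀ n, A n | ∀ n, f n (x (n + 1)) = x n} from
    isCompact_iff_compactSpace.1 h.isCompact
  have : {x : ∀ n, A n | ∀ n, f n (x (n + 1)) = x n} = ⋂ n, {x | f n (x (n + 1)) = x n} := by
    ext x; simp
  rw [this]
  exact isClosed_iInter fun n =>
    isClosed_eq ((hc n).comp (continuous_apply _)) (continuous_apply _)

theorem seqLim_proj_cont (n : ℕ) : Continuous (fun x : SeqLim A f => x.1 n) :=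
  (continuous_apply n).comp continuous_subtype_val

theorem seqLim_preconn (hc : ∀ n, Continuous (f n)) (K : Set (SeqLim A f)) (hK : IsClosed K)
    (n : ℕ) (hp : ∀ m, n ≤ m → IsPreconnected ((fun x : SeqLim A f => x.1 m) '' K)) :
    IsPreconnected K := by
  have := seqLim_compact hc
  rw [isPreconnected_closed_iff]
  rintro t t' ht ht' hsub ⟨x, hx⟩ ⟨y, hy⟩
  let S : ℕ → Set (SeqLim A f × SeqLim A f) := fun k =>
    ((K ∩ t) ×ˢ (K ∩ t')) ∩ {p | p.1.1 (n + k) = p.2.1 (n + k)}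
  have hScl : ∀ k, IsClosed (S k) := fun k =>
    ((hK.inter ht).prod (hK.inter ht')).inter
      (isClosed_eq ((seqLim_proj_cont _).comp continuous_fst)
        ((seqLim_proj_cont _).comp continuous_snd))
  have hne : ∀ k, (S k).Nonempty := by
    intro k
    have hcm : IsClosedMap (fun x : SeqLim A f => x.1 (n + k)) :=
      (seqLim_proj_cont (n + k)).isClosedMap
    obtain ⟨z, -, ⟨a, ha, haz⟩, ⟨b, hb, hbz⟩⟩ := isPreconnected_closed_iff.1 (hp (n + k) (by omega))
      _ _ (hcm _ (hK.inter ht)) (hcm _ (hK.inter ht'))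
      (by
        rintro _ ⟨u, hu, rfl⟩
        rcases hsub hu with h | h
        · exact Or.inl ⟨u, ⟨hu, h⟩, rfl⟩
        · exact Or.inr ⟨u, ⟨hu, h⟩, rfl⟩)
      ⟨_, ⟨x, hx.1, rfl⟩, ⟨x, hx, rfl⟩⟩ ⟨_, ⟨y, hy.1, rfl⟩, ⟨y, hy, rfl⟩⟩
    exact ⟨(a, b), ⟨ha, hb⟩, haz.trans hbz.symm⟩
  obtain ⟨⟨a, b⟩, hab⟩ := IsCompact.nonempty_iInter_of_sequence_nonempty_isCompact_isClosed S
    (by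
      rintro k ⟨a, b⟩ ⟨h1, h2⟩
      exact ⟨h1, seqLim_down a b (by omega) h2⟩) hne (hScl 0).isCompact hScl
  have hab' := mem_iInter.1 hab
  have : a = b := by
    ext k
    exact seqLim_down a b (by omega) (hab' k).2
  subst this
  exact ⟨a, (hab' 0).1.1.1, (hab' 0).1.1.2, (hab' 0).1.2.2⟩

theorem seqLim_preconn_preimage (hc : ∀ n, Continuous (f n)) (hs : ∀ n, Surjective (f n))
    (hm : ∀ n, ∀ y : A n, IsPreconnected ((f n) ⁻¹' {y})) (n : ℕ) {B : Set (A n)}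
    (hB : IsPreconnected B) : IsPreconnected ((fun x : SeqLim A f => x.1 n) ⁻¹' B) := by
  have := seqLim_compact hc
  refine preconn_preimage _ (seqLim_proj_cont n).isClosedMap (seqLim_surj n A f hs) ?_ hB
  intro z
  refine seqLim_preconn hc _ (isClosed_singleton.preimage (seqLim_proj_cont n)) n ?_
  intro m hnm
  induction m, hnm using Nat.le_induction with
  | base =>
    apply Set.Subsingleton.isPreconnected
    rintro _ ⟨x, hx, rfl⟩ _ ⟨y, hy, rfl⟩
    exact (mem_singleton_iff.1 hx).trans (mem_singleton_iff.1 hy).symm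
  | succ m hnm ih =>
    have := preconn_preimage (f m) (hc m).isClosedMap (hs m) (hm m) ih
    convert this using 1
    ext w
    constructor
    · rintro ⟨x, hx, rfl⟩
      exact ⟨x, hx, (x.2 m).symm⟩
    · rintro ⟨x, hx, hxw⟩
      obtain ⟨y, rfl⟩ := seqLim_surj (m + 1) A f hs w
      refine ⟨y, ?_, rfl⟩
      have : x.1 m = y.1 m := hxw.trans (y.2 m)
      have := seqLim_down x y hnm this
      rw [mem_preimage, ← this]
      exact hx

theorem edge_embedding (hc : ∀ n, Continuous (f n)) (hs : ∀ n, Surjective (f n))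
    (hm : ∀ n, ∀ y : A n, IsPreconnected ((f n) ⁻¹' {y}))
    (V : ∀ n, Set (A n)) (hV : ∀ n, ∀ v ∈ V (n + 1), f n v ∈ V n)
    (E : ℕ → Type) [∀ n, TopologicalSpace (E n)] [∀ n, DiscreteTopology (E n)]
    (φ : ∀ n, ((V n)ᶜ : Set (A n)) ≃ₜ (E n × ↥(Set.Ioo (0 : ℝ) 1))) (n : ℕ) (c : E n)
    (U : Set (SeqLim A f))
    (hU : U = {x | ∃ h : x.1 n ∈ (V n)ᶜ, (φ n ⟨x.1 n, h⟩).1 = c}) :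
    IsPreconnected U ∧ ∃ g : U → ℝ, IsOpenEmbedding g ∧ ∀ z, |g z| ≤ 2 := by
  have := seqLim_compact hc
  let F : ∀ m, E m → ↥(Set.Ioo (0 : ℝ) 1) → A m := fun m d t => ((φ m).symm (d, t)).1
  have hFc : ∀ m d, Continuous (F m d) := fun m d =>
    continuous_subtype_val.comp ((φ m).symm.continuous.comp (by fun_prop))
  have hUF : U = (fun x : SeqLim A f => x.1 n) ⁻¹' (range (F n c)) := by
    rw [hU]
    ext x
    constructor
    · rintro ⟨h, rfl⟩
      exact ⟨(φ n ⟨x.1 n, h⟩).2, by simp [F]⟩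
    · rintro ⟨t, ht⟩
      have ht' : F n c t = x.1 n := ht
      have h : x.1 n ∈ (V n)ᶜ := by
        rw [← ht']; exact ((φ n).symm (c, t)).2
      refine ⟨h, ?_⟩
      have : (⟨x.1 n, h⟩ : ((V n)ᶜ : Set (A n))) = (φ n).symm (c, t) := Subtype.ext ht'.symm
      rw [this]; simp
  have : PreconnectedSpace ↥(Set.Ioo (0 : ℝ) 1) :=
    Subtype.preconnectedSpace isPreconnected_Ioo
  have hUp : IsPreconnected U := by
    rw [hUF]
    exact seqLim_preconn_preimage hc hs hm n (isPreconnected_range (hFc n c))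
  refine ⟨hUp, ?_⟩
  have : PreconnectedSpace U := Subtype.preconnectedSpace hUp
  have hmem : ∀ (k : ℕ) (x : U), x.1.1 (n + k) ∈ (V (n + k))ᶜ := by
    intro k x
    induction k with
    | zero =>
      exact (hU.le x.2).1
    | succ k ih =>
      intro h
      apply ih
      rw [← x.1.2]
      exact hV _ _ h
  let Φ : ∀ k, U → E (n + k) × ↥(Set.Ioo (0 : ℝ) 1) := fun k x =>
    φ (n + k) ⟨x.1.1 (n + k), hmem k x⟩
  have hΦc : ∀ k, Continuous (Φ k) := fun k => (φ (n + k)).continuous.comp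
    (((seqLim_proj_cont (n + k)).comp continuous_subtype_val).subtype_mk _)
  have hΦ1 : ∀ k x y, (Φ k x).1 = (Φ k y).1 := fun k x y =>
    PreconnectedSpace.constant inferInstance (continuous_fst.comp (hΦc k))
  have hFΦ : ∀ k x, F (n + k) (Φ k x).1 (Φ k x).2 = x.1.1 (n + k) := by
    intro k x; simp [F, Φ]
  have heq : ∀ k x y, (Φ k x).2 = (Φ k y).2 → x.1.1 (n + k) = y.1.1 (n + k) := by
    intro k x y h
    rw [← hFΦ, ← hFΦ k y, h, hΦ1 k x y]
  have heq' : ∀ k (x y : U), x.1.1 (n + k) = y.1.1 (n + k) → Φ k x = Φ k y := by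
    intro k x y h
    simp only [Φ, h]
  let ψ : ℕ → U → ℝ := fun k x => ((Φ k x).2 : ℝ)
  have hψc : ∀ k, Continuous (ψ k) := fun k =>
    continuous_subtype_val.comp (continuous_snd.comp (hΦc k))
  have hΦ0 : ∀ x, (Φ 0 x).1 = c := by
    intro x
    exact (hU.le x.2).2
  have hψ0 : ∀ t : ↥(Set.Ioo (0 : ℝ) 1), ∃ x : U, (Φ 0 x).2 = t := by
    intro t
    obtain ⟨x, hx⟩ := seqLim_surj n A f hs (F n c t)
    have hxU : x ∈ U := by rw [hUF]; exact ⟨t, hx.symm⟩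
    refine ⟨⟨x, hxU⟩, ?_⟩
    have h1 : (⟨x.1 n, hmem 0 ⟨x, hxU⟩⟩ : ((V n)ᶜ : Set (A n))) = (φ n).symm (c, t) :=
      Subtype.ext hx
    have h2 : Φ 0 ⟨x, hxU⟩ = φ n ⟨x.1 n, hmem 0 ⟨x, hxU⟩⟩ := rfl
    rw [h2, h1]; simp
  refine interval_embedding ψ hψc ?_ ?_ ?_ ?_ ?_ ?_ ?_
  · intro k x
    have := (Φ k x).2.2
    rw [abs_le]
    exact ⟨by linarith [this.1], this.2.le⟩
  · intro k x y h
    have h1 := heq (k + 1) x y (Subtype.ext h)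
    have h2 := seqLim_down x.1 y.1 (by omega : n + k ≤ n + (k + 1)) h1
    simp only [ψ, heq' k x y h2]
  · intro k S hS
    rcases (ψ k ⁻¹' S).eq_empty_or_nonempty with he | ⟨u, -⟩
    · rw [he]; exact isPreconnected_empty
    rw [← Topology.IsInducing.subtypeVal.isPreconnected_image]
    have hI : IsPreconnected ((range fun x => (Φ k x).2) ∩ Subtype.val ⁻¹' S) := by
      rw [← Topology.IsInducing.subtypeVal.isPreconnected_image]
      rw [image_inter_preimage]
      apply Set.OrdConnected.isPreconnected
      refine Set.OrdConnected.inter ?_ hS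
      rw [← range_comp]
      exact (isPreconnected_range (hψc k)).ordConnected
    have := seqLim_preconn_preimage hc hs hm (n + k) (hI.image _ (hFc (n + k) (Φ k u).1).continuousOn)
    convert this using 1
    ext x
    constructor
    · rintro ⟨y, hy, rfl⟩
      refine ⟨(Φ k y).2, ⟨⟨y, rfl⟩, hy⟩, ?_⟩
      rw [hΦ1 k u y]
      exact hFΦ k y
    · rintro ⟨t, ⟨⟨y, rfl⟩, hyS⟩, hx⟩
      simp only at hx
      rw [hΦ1 k u y, hFΦ] at hx
      have hxn := seqLim_down y.1 x (by omega : n ≤ n + k) hx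
      have hxU : x ∈ U := by
        have := hUF.le y.2
        simp only [mem_preimage, hxn] at this
        rw [hUF]; exact this
      refine ⟨⟨x, hxU⟩, ?_, rfl⟩
      have := heq' k y ⟨x, hxU⟩ hx
      simp only [mem_preimage, ψ, ← this]
      exact hyS
  · intro x y h
    apply Subtype.ext
    apply Subtype.ext
    funext k
    exact seqLim_down x.1 y.1 (by omega : k ≤ n + k) (heq k x y (Subtype.ext (h k)))
  · intro x
    have h := (Φ 0 x).2.2
    obtain ⟨t, ht1, ht2⟩ := exists_between h.1
    obtain ⟨y, hy⟩ := hψ0 ⟨t, ht1, ht2.trans h.2⟩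
    exact ⟨y, by simp only [ψ, hy]; exact ht2⟩
  · intro x
    have h := (Φ 0 x).2.2
    obtain ⟨t, ht1, ht2⟩ := exists_between h.2
    obtain ⟨y, hy⟩ := hψ0 ⟨t, h.1.trans ht1, ht2⟩
    exact ⟨y, by simp only [ψ, hy]; exact ht1⟩
  · intro p q
    rw [Topology.IsInducing.subtypeVal.isCompact_iff]
    have hK : IsCompact (F n c '' (Icc (Φ 0 p).2 (Φ 0 q).2)) := by
      refine IsCompact.image ?_ (hFc n c)
      rw [Topology.IsInducing.subtypeVal.isCompact_iff]
      convert isCompact_Icc (a := ((Φ 0 p).2 : ℝ)) (b := ((Φ 0 q).2 : ℝ)) using 1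
      ext t
      constructor
      · rintro ⟨s, hs, rfl⟩
        exact hs
      · intro ht
        exact ⟨⟨t, lt_of_lt_of_le (Φ 0 p).2.2.1 ht.1, lt_of_le_of_lt ht.2 (Φ 0 q).2.2.2⟩, ht, rfl⟩
    have := (hK.isClosed.preimage (seqLim_proj_cont (f := f) n)).isCompact
    convert this using 1
    ext x
    constructor
    · rintro ⟨y, hy, rfl⟩
      refine ⟨(Φ 0 y).2, hy, ?_⟩
      have := hFΦ 0 y
      rw [hΦ0] at this
      exact this
    · rintro ⟨t, ht, hx⟩
      have hxU : x ∈ U := by rw [hUF]; exact ⟨t, hx⟩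
      refine ⟨⟨x, hxU⟩, ?_, rfl⟩
      have h1 : (⟨x.1 n, hmem 0 ⟨x, hxU⟩⟩ : ((V n)ᶜ : Set (A n))) = (φ n).symm (c, t) :=
        Subtype.ext hx.symm
      have h2 : Φ 0 ⟨x, hxU⟩ = φ n ⟨x.1 n, hmem 0 ⟨x, hxU⟩⟩ := rfl
      have h3 : (Φ 0 ⟨x, hxU⟩).2 = t := by rw [h2, h1]; simp
      simp only [mem_preimage, ψ, h3]
      exact ht

end

theorem finite_edges {X : Type} [TopologicalSpace X] (G : GraphLike X)
    (hfin : {e | G.IsEdge e}.Finite) [TopologicalSpace G.E] [DiscreteTopology G.E]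
    (φ : ((G.V)ᶜ : Set X) ≃ₜ (G.E × ↥(Set.Ioo (0 : ℝ) 1))) : Finite G.E := by
  have : PreconnectedSpace ↥(Set.Ioo (0 : ℝ) 1) :=
    Subtype.preconnectedSpace isPreconnected_Ioo
  let t0 : ↥(Set.Ioo (0 : ℝ) 1) := ⟨1 / 2, by norm_num, by norm_num⟩
  let b : G.E → X := fun c => (φ.symm (c, t0)).1
  have hb : ∀ c, b c ∈ (G.V)ᶜ := fun c => (φ.symm (c, t0)).2
  have : Finite {e | G.IsEdge e} := hfin
  let F : G.E → {e | G.IsEdge e} := fun c => ⟨connectedComponentIn (G.V)ᶜ (b c), b c, hb c, rfl⟩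
  refine Finite.of_injective F ?_
  intro c d h
  have h' : connectedComponentIn (G.V)ᶜ (b c) = connectedComponentIn (G.V)ᶜ (b d) :=
    congrArg Subtype.val h
  rw [connectedComponentIn_eq_image (hb c), connectedComponentIn_eq_image (hb d)] at h'
  have h2 : (⟨b d, hb d⟩ : ((G.V)ᶜ : Set X)) ∈ connectedComponent ⟨b c, hb c⟩ := by
    have : b d ∈ Subtype.val '' connectedComponent (⟨b d, hb d⟩ : ((G.V)ᶜ : Set X)) :=
      ⟨_, mem_connectedComponent, rfl⟩
    rw [← h'] at this
    obtain ⟨y, hy, hyd⟩ := this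
    have : y = ⟨b d, hb d⟩ := Subtype.ext hyd
    rwa [this] at hy
  have h3 := isPreconnected_connectedComponent.constant
    (f := fun y : ((G.V)ᶜ : Set X) => (φ y).1)
    (continuous_fst.comp φ.continuous).continuousOn
    (mem_connectedComponent (x := (⟨b c, hb c⟩ : ((G.V)ᶜ : Set X)))) h2
  simpa [b] using h3

theorem invLim_graphLike_continuum (Y : ℕ → TopGraphLike)
    (hfin : ∀ n, (Y n).IsFiniteMultiGraph)
    (hconn : ∀ n, ConnectedSpace (Y n).carrier)
    (f : ∀ n, (Y (n + 1)).carrier → (Y n).carrier)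
    (hcont : ∀ n, Continuous (f n))
    (hsurj : ∀ n, Function.Surjective (f n))
    (hmono : ∀ n, ∀ y : (Y n).carrier, IsPreconnected ((f n) ⁻¹' {y}))
    (hV : ∀ n, ∀ v ∈ (Y (n + 1)).gl.V, f n v ∈ (Y n).gl.V) :
    ConnectedSpace (InvLim Y f) ∧ CompactSpace (InvLim Y f) ∧
    TopologicalSpace.MetrizableSpace (InvLim Y f) ∧
    Nonempty (GraphLike (InvLim Y f)) := by
  have hcomp : CompactSpace (InvLim Y f) := seqLim_compact (A := fun n => (Y n).carrier) hcont
  have hsc : ∀ n, SecondCountableTopology (Y n).carrier := by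
    intro n
    letI := TopologicalSpace.metrizableSpaceMetric (Y n).carrier
    infer_instance
  have hsc' : SecondCountableTopology (∀ n, (Y n).carrier) := inferInstance
  have hsc2 : SecondCountableTopology (InvLim Y f) :=
    Topology.IsInducing.subtypeVal.secondCountableTopology
  refine ⟨?_, hcomp, TopologicalSpace.metrizableSpace_of_t3_secondCountable _, ?_⟩
  · have hp : IsPreconnected (univ : Set (InvLim Y f)) :=
      seqLim_preconn_preimage (A := fun n => (Y n).carrier) hcont hsurj hmono 0
        (B := univ) isPreconnected_univ
    obtain ⟨z⟩ := (hconn 0).toNonempty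
    obtain ⟨x, -⟩ := seqLim_surj 0 (fun n => (Y n).carrier) f hsurj z
    exact @ConnectedSpace.mk _ _ ⟨hp⟩ ⟨x⟩
  letI tE : ∀ n, TopologicalSpace (Y n).gl.E := fun n => ⊥
  have dE : ∀ n, DiscreteTopology (Y n).gl.E := fun n => ⟨rfl⟩
  have φ : ∀ n, (((Y n).gl.V)ᶜ : Set (Y n).carrier) ≃ₜ
      ((Y n).gl.E × ↥(Set.Ioo (0 : ℝ) 1)) := fun n => (Y n).gl.homeo.some
  have hEfin : ∀ n, Finite (Y n).gl.E := fun n => finite_edges (Y n).gl (hfin n).2 (φ n)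
  let U : ∀ n, (Y n).gl.E → Set (InvLim Y f) := fun n c =>
    {x | ∃ h : x.1 n ∈ ((Y n).gl.V)ᶜ, (φ n ⟨x.1 n, h⟩).1 = c}
  have hedge := fun n c => edge_embedding (A := fun n => (Y n).carrier) hcont hsurj hmono
    (fun n => (Y n).gl.V) hV (fun n => (Y n).gl.E) φ n c (U n c) rfl
  have hpc : ∀ n, Continuous (fun x : InvLim Y f => x.1 n) := fun n =>
    (continuous_apply n).comp continuous_subtype_val
  have hUW : ∀ n, (⋃ c, U n c) = {x | x.1 n ∉ (Y n).gl.V} := by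
    intro n
    ext x
    constructor
    · intro h
      obtain ⟨c, h, -⟩ := mem_iUnion.1 h
      exact h
    · intro h
      exact mem_iUnion.2 ⟨_, h, rfl⟩
  obtain ⟨W, hWo, hWc, E, tE', dE', ⟨hh⟩⟩ := assembly (fun n => (Y n).gl.E) U
    (by
      intro n c
      have hop : IsOpen {x : InvLim Y f | x.1 n ∈ ((Y n).gl.V)ᶜ} :=
        (Y n).gl.closedV.isOpen_compl.preimage (hpc n)
      have hcl : Continuous (fun x : {x : InvLim Y f | x.1 n ∈ ((Y n).gl.V)ᶜ} =>
          (φ n ⟨x.1.1 n, x.2⟩).1) :=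
        continuous_fst.comp ((φ n).continuous.comp
          (((hpc n).comp continuous_subtype_val).subtype_mk _))
      have := hop.isOpenMap_subtype_val _ ((isOpen_discrete {c}).preimage hcl)
      convert this using 1
      ext x
      constructor
      · rintro ⟨h, hx⟩
        exact ⟨⟨x, h⟩, hx, rfl⟩
      · rintro ⟨⟨y, h⟩, hx, rfl⟩
        exact ⟨h, hx⟩)
    (fun n c => (hedge n c).1)
    (by
      rintro n c c' x ⟨h, rfl⟩ ⟨h', rfl⟩
      rfl)
    (by
      intro n
      rw [hUW, hUW]
      intro x hx h
      apply hx
      rw [← x.2]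
      exact hV n _ h)
    (fun n c => (hedge n c).2)
  obtain rfl := dE'.eq_bot
  refine ⟨⟨Wᶜ, hWo.isClosed_compl, ?_, E, ?_⟩⟩
  · rw [totallyDisconnectedSpace_subtype_iff]
    intro K hK hKp x hx y hy
    apply Subtype.ext
    funext n
    letI := TopologicalSpace.metrizableSpaceMetric (Y n).carrier
    have hcount : ((Y n).gl.V ∪ (fun x : InvLim Y f => x.1 n) ''
        ((⋃ n, ⋃ c, U n c) \ W)).Countable :=
      (hfin n).1.countable.union (hWc.image _)
    refine hcount.isTotallyDisconnected ((fun x : InvLim Y f => x.1 n) '' K) ?_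
      (hKp.image _ (hpc n).continuousOn) ⟨x, hx, rfl⟩ ⟨y, hy, rfl⟩
    rintro _ ⟨z, hz, rfl⟩
    by_cases h : z.1 n ∈ (Y n).gl.V
    · exact Or.inl h
    · refine Or.inr ⟨z, ⟨mem_iUnion.2 ⟨n, ?_⟩, hK hz⟩, rfl⟩
      rw [hUW]
      exact h
  · letI : TopologicalSpace E := ⊥
    exact ⟨(Homeomorph.setCongr (compl_compl W)).trans hh⟩
end
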